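/- Theorem 3.1 (global convergence and iteration complexity of ADMM): Under the stated assumptions (a)–(e) together with the Łojasiewicz assumption on the augmented Lagrangian with some exponent α ∈ [0,1), the full ADMM sequence {(U^k, V^k, λ^k)}_{k ≥ 0} converges to a KKT point (Ū, V̄, λ̄) of the penalized problem; moreover, the total number of iterations required to produce an ε-KKT point of the penalized problem is O(ε^{-1}). -/

import Mathlib

open Matrix
open scoped BigOperators

noncomputable section

/-- Frobenius inner product of two real matrices. -/
def frobInner {α β : Type*} [Fintype α] [Fintype β] (X Y : Matrix α β ℝ) : ℝ :=
  ∑ i, ∑ j, X i j * Y i j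

/-- Frobenius norm of a real matrix. -/
def frobNorm {α β : Type*} [Fintype α] [Fintype β] (X : Matrix α β ℝ) : ℝ :=
  Real.sqrt (∑ i, ∑ j, (X i j) ^ 2)

/-- Euclidean norm of a real vector. -/
def vecNorm {α : Type*} [Fintype α] (v : α → ℝ) : ℝ :=
  Real.sqrt (∑ i, (v i) ^ 2)

/-- The linear map `𝒜(X) = (⟨A 1, X⟩, …, ⟨A m, X⟩)`. -/
def Aop {n m : ℕ} (A : Fin m → Matrix (Fin n) (Fin n) ℝ)
    (X : Matrix (Fin n) (Fin n) ℝ) : Fin m → ℝ :=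
  fun i => frobInner (A i) X

/-- `s_A = Σ_i ‖A_i‖_F²`. -/
def sA {n m : ℕ} (A : Fin m → Matrix (Fin n) (Fin n) ℝ) : ℝ :=
  ∑ i, (frobNorm (A i)) ^ 2

/-- `(U, V, λ)` is an ε-KKT point of the penalized problem
`min f(UVᵀ) + (γ/2)‖U-V‖² s.t. 𝒜(UVᵀ) = b`, where `grad` denotes the gradient of `f`. -/
def IsPenEpsKKT {n m r : ℕ} (grad : Matrix (Fin n) (Fin n) ℝ → Matrix (Fin n) (Fin n) ℝ)
    (A : Fin m → Matrix (Fin n) (Fin n) ℝ) (b : Fin m → ℝ) (γ ε : ℝ)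
    (U V : Matrix (Fin n) (Fin r) ℝ) (lam : Fin m → ℝ) : Prop :=
  frobNorm (grad (U * Vᵀ) * V + γ • (U - V) + ∑ i, lam i • (A i * V)) ≤ ε ∧
  frobNorm (grad (V * Uᵀ) * U + γ • (V - U) + ∑ i, lam i • (A i * U)) ≤ ε ∧
  vecNorm (fun i => Aop A (U * Vᵀ) i - b i) ≤ ε

/-- `(U, λ)` is an ε-KKT point of the Burer–Monteiro problem
`min f(UUᵀ) s.t. 𝒜(UUᵀ) = b`, where `grad` denotes the gradient of `f`. -/
def IsBMEpsKKT {n m r : ℕ} (grad : Matrix (Fin n) (Fin n) ℝ → Matrix (Fin n) (Fin n) ℝ)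
    (A : Fin m → Matrix (Fin n) (Fin n) ℝ) (b : Fin m → ℝ) (ε : ℝ)
    (U : Matrix (Fin n) (Fin r) ℝ) (lam : Fin m → ℝ) : Prop :=
  frobNorm ((2 : ℝ) • (grad (U * Uᵀ) * U) + ∑ i, lam i • (A i * U)) ≤ ε ∧
  vecNorm (fun i => Aop A (U * Uᵀ) i - b i) ≤ ε

/-- The augmented Lagrangian `L_ρ(U,V,λ)` of the penalized problem. -/
def augL {n m r : ℕ} (f : Matrix (Fin n) (Fin n) ℝ → ℝ)
    (A : Fin m → Matrix (Fin n) (Fin n) ℝ) (b : Fin m → ℝ) (ρ γ : ℝ)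
    (U V : Matrix (Fin n) (Fin r) ℝ) (lam : Fin m → ℝ) : ℝ :=
  f (U * Vᵀ) + γ / 2 * (frobNorm (U - V)) ^ 2
    + ∑ i, lam i * (Aop A (U * Vᵀ) i - b i)
    + ρ / 2 * (vecNorm (fun i => Aop A (U * Vᵀ) i - b i)) ^ 2

/-- The level set `S_β` of the penalty function. -/
def Sset {n m r : ℕ} (f : Matrix (Fin n) (Fin n) ℝ → ℝ)
    (A : Fin m → Matrix (Fin n) (Fin n) ℝ) (b : Fin m → ℝ) (ρ₀ β : ℝ) :
    Set (Matrix (Fin n) (Fin r) ℝ × Matrix (Fin n) (Fin r) ℝ) :=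
  {p | f (p.1 * p.2ᵀ) + ρ₀ / 2 * (frobNorm (p.1 - p.2)) ^ 2
      + ρ₀ / 2 * (vecNorm (fun i => Aop A (p.1 * p.2ᵀ) i - b i)) ^ 2 ≤ β}

/-- `𝒞(U)`: the `nr × m` matrix whose `i`-th column is the vectorization of `A_i U`. -/
def Cmat {n m r : ℕ} (A : Fin m → Matrix (Fin n) (Fin n) ℝ)
    (U : Matrix (Fin n) (Fin r) ℝ) : Matrix (Fin n × Fin r) (Fin m) ℝ :=
  Matrix.of fun p i => (A i * U) p.1 p.2

/-- Smallest singular value of a real matrix, as the infimum of `‖Mx‖` over unit vectors. -/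
def sigmaMin {α β : Type*} [Fintype α] [Fintype β] (M : Matrix α β ℝ) : ℝ :=
  sInf {s | ∃ x : β → ℝ, vecNorm x = 1 ∧ s = vecNorm (M.mulVec x)}

/-- Norm of the full gradient of the augmented Lagrangian at `(U, V, λ)`
(for symmetric `f`, with `grad` the gradient of `f`). -/
def gradAugLNorm {n m r : ℕ} (grad : Matrix (Fin n) (Fin n) ℝ → Matrix (Fin n) (Fin n) ℝ)
    (A : Fin m → Matrix (Fin n) (Fin n) ℝ) (b : Fin m → ℝ) (ρ γ : ℝ)
    (U V : Matrix (Fin n) (Fin r) ℝ) (lam : Fin m → ℝ) : ℝ :=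
  Real.sqrt
    ((frobNorm (grad (U * Vᵀ) * V + γ • (U - V)
        + ∑ i, (lam i + ρ * (Aop A (U * Vᵀ) i - b i)) • (A i * V))) ^ 2
      + (frobNorm (grad (V * Uᵀ) * U + γ • (V - U)
        + ∑ i, (lam i + ρ * (Aop A (U * Vᵀ) i - b i)) • (A i * U))) ^ 2
      + (vecNorm (fun i => Aop A (U * Vᵀ) i - b i)) ^ 2)

/-- Distance between two primal-dual triples, induced by the Frobenius/Euclidean norms. -/
def tripDist {n m r : ℕ}
    (p q : Matrix (Fin n) (Fin r) ℝ × Matrix (Fin n) (Fin r) ℝ × (Fin m → ℝ)) : ℝ :=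
  Real.sqrt ((frobNorm (p.1 - q.1)) ^ 2 + (frobNorm (p.2.1 - q.2.1)) ^ 2
    + (vecNorm (fun i => p.2.2 i - q.2.2 i)) ^ 2)

/-- The set `𝒲` of KKT points of the penalized problem. -/
def KKTset {n m : ℕ} (r : ℕ) (grad : Matrix (Fin n) (Fin n) ℝ → Matrix (Fin n) (Fin n) ℝ)
    (A : Fin m → Matrix (Fin n) (Fin n) ℝ) (b : Fin m → ℝ) (γ : ℝ) :
    Set (Matrix (Fin n) (Fin r) ℝ × Matrix (Fin n) (Fin r) ℝ × (Fin m → ℝ)) :=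
  {p | IsPenEpsKKT grad A b γ 0 p.1 p.2.1 p.2.2}

section OneSided

open Filter Topology

lemma nonneg_of_hasDerivAt_of_eventually_ge {φ : ℝ → ℝ} {φ' : ℝ} (h : HasDerivAt φ φ' 0)
    (hge : ∀ᶠ t in 𝓝[>] (0 : ℝ), φ 0 ≤ φ t) : 0 ≤ φ' := by
  refine ge_of_tendsto h.tendsto_slope_zero_right ?_
  filter_upwards [hge, self_mem_nhdsWithin] with t ht (ht0 : 0 < t)
  rw [zero_add, smul_eq_mul]
  exact mul_nonneg (inv_nonneg.mpr ht0.le) (sub_nonneg.mpr ht)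

lemma eventually_lt_of_hasDerivAt_neg {φ : ℝ → ℝ} {φ' : ℝ} (h : HasDerivAt φ φ' 0)
    (hneg : φ' < 0) : ∀ᶠ t in 𝓝[>] (0 : ℝ), φ t < φ 0 := by
  filter_upwards [h.tendsto_slope_zero_right.eventually_lt_const hneg, self_mem_nhdsWithin]
    with t ht (ht0 : 0 < t)
  rw [zero_add, smul_eq_mul] at ht
  exact sub_neg.mp (neg_of_mul_neg_right ht (inv_nonneg.mpr ht0.le))

open scoped RealInnerProductSpace in
/-- Farkas' lemma for a single strict inequality. -/
lemma exists_add_smul_eq_zero_of_forall_inner {H : Type*} [NormedAddCommGroup H]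
    [InnerProductSpace ℝ H] {p q : H} (hp : p ≠ 0)
    (h : ∀ D, ⟪p, D⟫ < 0 → 0 ≤ ⟪q, D⟫) : ∃ τ : ℝ, 0 ≤ τ ∧ q + τ • p = 0 := by
  have hpp : 0 < ‖p‖ ^ 2 := by positivity
  have hqp : ⟪q, p⟫ ≤ 0 := by
    have := h (-p) (by rw [inner_neg_right, real_inner_self_eq_norm_sq]; linarith)
    rw [inner_neg_right] at this
    linarith
  refine ⟨-⟪q, p⟫ / ‖p‖ ^ 2, div_nonneg (by linarith) hpp.le, ?_⟩
  set τ := -⟪q, p⟫ / ‖p‖ ^ 2 with hτ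
  have hτp : τ * ‖p‖ ^ 2 = -⟪q, p⟫ := div_mul_cancel₀ _ hpp.ne'
  have horth : ⟪q + τ • p, p⟫ = 0 := by
    rw [inner_add_left, real_inner_smul_left, real_inner_self_eq_norm_sq]; linarith
  have hle : ∀ ε : ℝ, 0 < ε → ‖q + τ • p‖ ^ 2 ≤ 0 + ε * (-⟪q, p⟫) := fun ε hε => by
    have h1 := h (-(ε • p) - (q + τ • p)) (by
      rw [inner_sub_right, inner_neg_right, real_inner_smul_right, real_inner_self_eq_norm_sq,
        real_inner_comm, horth]
      nlinarith)
    have h2 : ⟪q, q + τ • p⟫ = ‖q + τ • p‖ ^ 2 := by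
      rw [← real_inner_self_eq_norm_sq, inner_add_left, real_inner_smul_left,
        real_inner_comm _ p, horth]
      ring
    rw [inner_sub_right, inner_neg_right, real_inner_smul_right, h2] at h1
    linarith
  have hlim : Tendsto (fun ε : ℝ => 0 + ε * (-⟪q, p⟫)) (𝓝[>] 0) (𝓝 0) := by
    have : Continuous fun ε : ℝ => 0 + ε * (-⟪q, p⟫) := by fun_prop
    simpa using (this.tendsto 0).mono_left nhdsWithin_le_nhds
  have h0 : ‖q + τ • p‖ ^ 2 ≤ 0 := ge_of_tendsto hlim (by
    filter_upwards [self_mem_nhdsWithin] with ε hε using hle ε hε)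
  exact norm_eq_zero.mp (pow_eq_zero_iff two_ne_zero |>.mp (le_antisymm h0 (sq_nonneg _)))

open scoped RealInnerProductSpace in
/-- Convexity estimate for weighted combinations of `l + z` and `θ • z`. -/
lemma combination_sq_le {W : Type*} [NormedAddCommGroup W] [InnerProductSpace ℝ W] {l z : W}
    {s θ : ℝ} (hs0 : 0 ≤ s) (hs1 : s ≤ 1) (hθ0 : 0 ≤ θ) (hθ1 : θ ≤ 1) :
    ‖s • l + (s + (1 - s) * θ) • z‖ ^ 2 - ‖l‖ ^ 2 - 2 * ⟪s • l + (s + (1 - s) * θ) • z, z⟫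
      + θ * ‖z‖ ^ 2 ≤ 0 := by
  have h0 : 0 ≤ ‖l + (1 - θ) • z‖ ^ 2 := sq_nonneg _
  simp only [norm_add_sq_real, norm_smul, mul_pow, Real.norm_eq_abs, sq_abs, inner_add_left,
    real_inner_smul_left, real_inner_smul_right, real_inner_self_eq_norm_sq] at h0 ⊢
  have h1 := mul_nonneg (mul_nonneg hs0 (sub_nonneg.mpr hs1)) h0
  have h2 := mul_nonneg (sub_nonneg.mpr hs1) (sq_nonneg ‖l‖)
  have h3 := mul_nonneg (mul_nonneg hs0 (sub_nonneg.mpr hθ1)) (sq_nonneg ‖z‖)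
  have h4 := mul_nonneg (mul_nonneg (mul_nonneg (sub_nonneg.mpr hs1) hθ0) (sub_nonneg.mpr hθ1))
    (sq_nonneg ‖z‖)
  nlinarith

end OneSided

section KurdykaLojasiewicz

open Filter Topology

/-- Concavity of the desingularizing function `s ↦ s ^ (1 - α) / (1 - α)`. -/
lemma rpow_neg_mul_sub_le {α x y : ℝ} (hα0 : 0 ≤ α) (hα1 : α < 1) (hx : 0 < x) (hy : 0 ≤ y) :
    x ^ (-α) * (x - y) ≤ x ^ (1 - α) / (1 - α) - y ^ (1 - α) / (1 - α) := by
  have hp : 0 < 1 - α := by linarith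
  have h1 : (1 + (y / x - 1)) ^ (1 - α) ≤ 1 + (1 - α) * (y / x - 1) :=
    rpow_one_add_le_one_add_mul_self (by have := div_nonneg hy hx.le; linarith) hp.le
      (by linarith)
  rw [add_sub_cancel, Real.div_rpow hy hx.le,
    div_le_iff₀ (Real.rpow_pos_of_pos hx _)] at h1
  have h2 : x ^ (1 - α) = x ^ (-α) * x := by
    rw [sub_eq_neg_add, Real.rpow_add hx, Real.rpow_one]
  rw [← sub_div, le_div_iff₀ hp]
  have h3 : (1 + (1 - α) * (y / x - 1)) * x ^ (1 - α)
      = x ^ (1 - α) + (1 - α) * (x ^ (-α) * (y - x)) := by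
    rw [h2]; field_simp
  rw [h3] at h1
  linarith

/-- A descent sequence whose values satisfy a Łojasiewicz inequality near a cluster point has
finite length and converges to that point. -/
theorem summable_and_tendsto_of_lojasiewicz {X : Type*} [PseudoMetricSpace X] {z : ℕ → X}
    {D l : ℕ → ℝ} {q : X} {C₀ C₁ κ ε α : ℝ} (hα0 : 0 ≤ α) (hα1 : α < 1) (hC₀ : 0 ≤ C₀)
    (hC₁ : 0 < C₁) (hκ : 0 < κ) (hε : 0 < ε) (hD : ∀ k, 0 ≤ D k) (hl : ∀ k, 0 ≤ l k)
    (hlim : Tendsto l atTop (𝓝 0)) (hstep : ∀ k, dist (z k) (z (k + 1)) ≤ C₀ * D k)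
    (hdec : ∀ k, κ * D k ^ 2 ≤ l k - l (k + 1))
    (hkl : ∀ k, dist (z (k + 1)) q ≤ ε → l (k + 1) ^ α ≤ C₁ * D k)
    {φ : ℕ → ℕ} (hφ : Tendsto φ atTop atTop) (hq : Tendsto (z ∘ φ) atTop (𝓝 q)) :
    Summable D ∧ Tendsto z atTop (𝓝 q) := by
  have hp : 0 < 1 - α := by linarith
  set ψ : ℕ → ℝ := fun k => l k ^ (1 - α) / (1 - α) with hψ
  set B := C₁ / κ with hB
  have hBpos : 0 < B := div_pos hC₁ hκ
  have hψ0 : ∀ k, 0 ≤ ψ k := fun k => div_nonneg (Real.rpow_nonneg (hl k) _) hp.le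
  have hψlim : Tendsto ψ atTop (𝓝 0) := by
    have h1 := (Real.continuousAt_rpow_const 0 (1 - α) (Or.inr hp.le)).tendsto.comp hlim
    rw [Real.zero_rpow hp.ne'] at h1
    simpa using h1.div_const (1 - α)
  have hDlim : Tendsto D atTop (𝓝 0) := by
    have h1 : Tendsto (fun k => (l k - l (k + 1)) / κ) atTop (𝓝 0) := by
      simpa using (hlim.sub ((tendsto_add_atTop_iff_nat 1).mpr hlim)).div_const κ
    have h2 : Tendsto (fun k => D k ^ 2) atTop (𝓝 0) :=
      squeeze_zero (fun k => sq_nonneg _)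
        (fun k => by rw [le_div_iff₀ hκ, mul_comm]; exact hdec k) h1
    have h3 := (Real.continuous_sqrt.tendsto 0).comp h2
    rw [Real.sqrt_zero] at h3
    exact h3.congr fun k => Real.sqrt_sq (hD k)
  have hrec : ∀ k, dist (z (k + 1)) q ≤ ε →
      2 * D (k + 1) ≤ D k + B * (ψ (k + 1) - ψ (k + 2)) := fun k hk => by
    have hd := hdec (k + 1)
    rcases (hl (k + 1)).eq_or_lt with h0 | hpos
    · have h2 : l (k + 2) = 0 := by
        have := mul_nonneg hκ.le (sq_nonneg (D (k + 1)))
        exact le_antisymm (by linarith) (hl _)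
      have h1 : D (k + 1) = 0 := by
        rw [← h0, h2, sub_zero] at hd
        have : D (k + 1) ^ 2 ≤ 0 := by nlinarith
        exact pow_eq_zero_iff two_ne_zero |>.mp (le_antisymm this (sq_nonneg _))
      have h3 : ψ (k + 1) = ψ (k + 2) := by simp only [hψ, ← h0, h2]
      rw [h1, h3, sub_self, mul_zero, mul_zero, add_zero]
      exact hD k
    · have hc := rpow_neg_mul_sub_le hα0 hα1 hpos (hl (k + 2))
      have hk' := hkl k hk
      have hlα : 0 < l (k + 1) ^ α := Real.rpow_pos_of_pos hpos α
      rw [Real.rpow_neg hpos.le, inv_mul_le_iff₀ hlα] at hc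
      have h4 : 0 ≤ ψ (k + 1) - ψ (k + 2) := by
        have h5 := hd.trans hc
        exact nonneg_of_mul_nonneg_right
          ((mul_nonneg hκ.le (sq_nonneg _)).trans h5) hlα
      have h5 : κ * D (k + 1) ^ 2 ≤ C₁ * D k * (ψ (k + 1) - ψ (k + 2)) :=
        (hd.trans hc).trans (mul_le_mul_of_nonneg_right hk' h4)
      have h6 : D (k + 1) ^ 2 ≤ D k * (B * (ψ (k + 1) - ψ (k + 2))) := by
        have e : D k * (B * (ψ (k + 1) - ψ (k + 2)))
            = (C₁ * D k * (ψ (k + 1) - ψ (k + 2))) / κ := by rw [hB]; ring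
        rw [e, le_div_iff₀ hκ, mul_comm]
        exact h5
      refine abs_le_of_sq_le_sq' ?_ (add_nonneg (hD k) (mul_nonneg hBpos.le h4)) |>.2
      nlinarith [sq_nonneg (D k - B * (ψ (k + 1) - ψ (k + 2)))]
  obtain ⟨N, hN1, hN2⟩ : ∃ N, dist (z N) q < ε / 2 ∧
      C₀ * (2 * D N + B * ψ (N + 1)) < ε / 2 := by
    have hsmall : Tendsto (fun k => C₀ * (2 * D k + B * ψ (k + 1))) atTop (𝓝 0) := by
      simpa using ((hDlim.const_mul 2).add
        (((tendsto_add_atTop_iff_nat 1).mpr hψlim).const_mul B)).const_mul C₀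
    have h1 := (hφ.eventually (hsmall.eventually_lt_const (half_pos hε)))
    have h2 := (tendsto_iff_dist_tendsto_zero.mp hq).eventually_lt_const (half_pos hε)
    obtain ⟨j, hj1, hj2⟩ := (h1.and h2).exists
    exact ⟨φ j, hj2, hj1⟩
  have hdist : ∀ k, dist (z N) (z (N + k)) ≤ C₀ * ∑ j ∈ Finset.range k, D (N + j) := by
    intro k
    induction k with
    | zero => simp
    | succ k ih =>
      rw [Finset.sum_range_succ, mul_add]
      exact (dist_triangle _ (z (N + k)) _).trans (add_le_add ih (hstep (N + k)))
  have hpot : ∀ k, (∑ j ∈ Finset.range (k + 1), D (N + j)) + D (N + k) + B * ψ (N + k + 1)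
      ≤ 2 * D N + B * ψ (N + 1) := by
    intro k
    induction k with
    | zero => simp [two_mul]
    | succ k ih =>
      have hsum : ∑ j ∈ Finset.range (k + 1), D (N + j) ≤ 2 * D N + B * ψ (N + 1) := by
        linarith [hD (N + k), mul_nonneg hBpos.le (hψ0 (N + k + 1))]
      have hnear : dist (z (N + k + 1)) q ≤ ε := by
        have h1 := hdist (k + 1)
        have h2 := mul_le_mul_of_nonneg_left hsum hC₀
        have h3 := dist_triangle_left (z (N + k + 1)) q (z N)
        rw [← add_assoc] at h1
        linarith
      have h4 := hrec (N + k) hnear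
      rw [Finset.sum_range_succ, ← add_assoc]
      linarith
  have hsum : Summable D := by
    rw [← summable_nat_add_iff N]
    refine summable_of_sum_range_le (c := 2 * D N + B * ψ (N + 1)) (fun k => hD _) fun k => ?_
    have h1 := hpot k
    rw [Finset.sum_range_succ] at h1
    simp only [add_comm _ N]
    linarith [hD (N + k), mul_nonneg hBpos.le (hψ0 (N + k + 1))]
  have hcauchy : CauchySeq z := cauchySeq_of_summable_dist
    (Summable.of_nonneg_of_le (fun _ => dist_nonneg) hstep (hsum.mul_left C₀))
  exact ⟨hsum, tendsto_nhds_of_cauchySeq_of_subseq hcauchy hφ hq⟩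

/-- Summable residual bounds yield an `O(ε⁻¹)` iteration count. -/
lemma exists_index_le_div_of_summable {D e : ℕ → ℝ} {C : ℝ} (hC : 0 ≤ C) (hD : ∀ k, 0 ≤ D k)
    (hsum : Summable D) (hle : ∀ k, e (k + 3) ≤ C * D k) :
    ∃ K : ℝ, 0 < K ∧ ∀ ε : ℝ, 0 < ε → ∃ k : ℕ, (k : ℝ) ≤ K / ε ∧ e k ≤ ε := by
  set T := C * ∑' k, D k
  have hT : 0 ≤ T := mul_nonneg hC (tsum_nonneg hD)
  refine ⟨T + 4 * |e 0| + 1, by positivity, fun ε hε => ?_⟩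
  by_cases h0 : e 0 ≤ ε
  · exact ⟨0, by simpa using by positivity, h0⟩
  obtain ⟨k, hk, hek⟩ : ∃ k ∈ Finset.range (⌈T / ε⌉₊ + 1), C * D k ≤ ε := by
    by_contra! hgt
    have h1 : (⌈T / ε⌉₊ + 1 : ℕ) * ε ≤ ∑ k ∈ Finset.range (⌈T / ε⌉₊ + 1), C * D k := by
      have := Finset.card_nsmul_le_sum _ _ ε fun k hk => (hgt k hk).le
      simpa using this
    have h2 : ∑ k ∈ Finset.range (⌈T / ε⌉₊ + 1), C * D k ≤ T := by
      rw [← Finset.mul_sum]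
      exact mul_le_mul_of_nonneg_left (hsum.sum_le_tsum _ fun k _ => hD k) hC
    have h3 : T < (⌈T / ε⌉₊ + 1 : ℕ) * ε := by
      rw [← div_lt_iff₀ hε]
      push_cast
      linarith [Nat.le_ceil (T / ε)]
    linarith
  refine ⟨k + 3, ?_, (hle k).trans hek⟩
  have h1 : (k : ℝ) ≤ ⌈T / ε⌉₊ := by
    exact_mod_cast Nat.lt_succ_iff.mp (Finset.mem_range.mp hk)
  have h2 := Nat.ceil_lt_add_one (div_nonneg hT hε.le)
  have h3 : 4 ≤ 4 * |e 0| / ε := by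
    rw [le_div_iff₀ hε]
    linarith [le_abs_self (e 0)]
  have h4 : 0 ≤ 1 / ε := by positivity
  push_cast
  rw [add_div, add_div]
  linarith

end KurdykaLojasiewicz

section FactoredModel

open scoped RealInnerProductSpace

/-- A convex objective in the product `U Vᵀ` together with affine constraints, viewed as a function
of the two factors. `partialGrad U V` is the gradient in the second factor; the gradient in the
first factor is `partialGrad V U` by symmetry. -/
structure FactoredModel (H W : Type*) [NormedAddCommGroup H] [InnerProductSpace ℝ H]
    [NormedAddCommGroup W] [InnerProductSpace ℝ W] where
  obj : H → H → ℝ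
  partialGrad : H → H → H
  constr : H →ₗ[ℝ] H →ₗ[ℝ] W
  adj : H →ₗ[ℝ] W →ₗ[ℝ] H
  rhs : W
  obj_symm : ∀ U V, obj U V = obj V U
  constr_symm : ∀ U V, constr U V = constr V U
  inner_adj : ∀ U V w, ⟪adj U w, V⟫ = ⟪w, constr U V⟫
  continuous_obj : Continuous fun p : H × H => obj p.1 p.2
  continuous_constr : Continuous fun p : H × H => constr p.1 p.2
  continuous_adj : Continuous fun p : H × W => adj p.1 p.2
  continuous_partialGrad : Continuous fun p : H × H => partialGrad p.1 p.2
  partialGrad_locally_lipschitz : ∀ R : ℝ, ∃ K : ℝ, 0 ≤ K ∧ ∀ U V V', ‖U‖ ≤ R → ‖V‖ ≤ R →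
    ‖V'‖ ≤ R → ‖partialGrad V' U - partialGrad V U‖ ≤ K * ‖V' - V‖
  hasDerivAt_obj : ∀ U V D, HasDerivAt (fun t : ℝ => obj U (V + t • D)) ⟪partialGrad U V, D⟫ 0
  obj_lower : ∀ U V V', obj U V + ⟪partialGrad U V, V' - V⟫ ≤ obj U V'
  obj_gauge : ∀ (t : ℝ) (U V : H), t ≠ 0 → obj (t • U) (t⁻¹ • V) = obj U V

namespace FactoredModel

variable {H W : Type*} [NormedAddCommGroup H] [InnerProductSpace ℝ H]
  [NormedAddCommGroup W] [InnerProductSpace ℝ W] (P : FactoredModel H W)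

/-- Constraint residual. -/
def res (U V : H) : W := P.constr U V - P.rhs

/-- Lagrangian with proximity weight `c` and constraint penalty `d`. -/
def lag (c d : ℝ) (U V : H) (w : W) : ℝ :=
  P.obj U V + c / 2 * ‖U - V‖ ^ 2 + ⟪w, P.res U V⟫ + d / 2 * ‖P.res U V‖ ^ 2

/-- Gradient of the unpenalized Lagrangian in the second factor. -/
def lagGrad (c : ℝ) (U V : H) (w : W) : H :=
  P.partialGrad U V + c • (V - U) + P.adj U w

lemma res_symm (U V : H) : P.res U V = P.res V U := by
  simp only [res, P.constr_symm U V]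

lemma lag_symm (c d : ℝ) (U V : H) (w : W) : P.lag c d U V w = P.lag c d V U w := by
  simp only [lag, P.res_symm U V, P.obj_symm U V, norm_sub_rev U V]

lemma res_sub (U V V' : H) : P.res U V' - P.res U V = P.constr U (V' - V) := by
  simp [res]

lemma res_line (U V D : H) (t : ℝ) : P.res U (V + t • D) = P.res U V + t • P.constr U D := by
  simp only [res, map_add, map_smul]; abel

lemma res_gauge {t : ℝ} (ht : t ≠ 0) (U V : H) : P.res (t • U) (t⁻¹ • V) = P.res U V := by
  simp [res, smul_smul, ht]

lemma continuous_res : Continuous fun p : H × H => P.res p.1 p.2 :=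
  P.continuous_constr.sub continuous_const

lemma continuous_lag (c d : ℝ) (w : W) : Continuous fun p : H × H => P.lag c d p.1 p.2 w := by
  have h1 := P.continuous_obj
  have h2 := P.continuous_res
  unfold lag
  fun_prop

lemma continuous_lagGrad (c : ℝ) : Continuous fun q : H × H × W => P.lagGrad c q.1 q.2.1 q.2.2 := by
  have h1 : Continuous fun q : H × H × W => P.partialGrad q.1 q.2.1 :=
    P.continuous_partialGrad.comp (by fun_prop : Continuous fun q : H × H × W => (q.1, q.2.1))
  have h2 : Continuous fun q : H × H × W => P.adj q.1 q.2.2 :=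
    P.continuous_adj.comp (by fun_prop : Continuous fun q : H × H × W => (q.1, q.2.2))
  unfold lagGrad
  fun_prop

lemma continuous_lag_triple (c d : ℝ) :
    Continuous fun q : H × H × W => P.lag c d q.1 q.2.1 q.2.2 := by
  have h1 : Continuous fun q : H × H × W => P.obj q.1 q.2.1 :=
    P.continuous_obj.comp (by fun_prop : Continuous fun q : H × H × W => (q.1, q.2.1))
  have h2 : Continuous fun q : H × H × W => P.res q.1 q.2.1 :=
    P.continuous_res.comp (by fun_prop : Continuous fun q : H × H × W => (q.1, q.2.1))
  unfold lag
  fun_prop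

lemma lag_zero (c d : ℝ) (U V : H) :
    P.lag c d U V 0 = P.obj U V + c / 2 * ‖U - V‖ ^ 2 + d / 2 * ‖P.res U V‖ ^ 2 := by
  simp [lag]

lemma lag_zero_mono {c c' d d' : ℝ} (hc : c ≤ c') (hd : d ≤ d') (U V : H) :
    P.lag c d U V 0 ≤ P.lag c' d' U V 0 := by
  simp only [lag_zero]; gcongr

lemma inner_lagGrad (c : ℝ) (U V D : H) (w : W) :
    ⟪P.lagGrad c U V w, D⟫ =
      ⟪P.partialGrad U V, D⟫ + c * ⟪V - U, D⟫ + ⟪w, P.constr U D⟫ := by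
  simp only [lagGrad, inner_add_left, real_inner_smul_left, P.inner_adj]

lemma lag_line (c d : ℝ) (U V D : H) (w : W) (t : ℝ) :
    P.lag c d U (V + t • D) w = P.obj U (V + t • D) + (c / 2 * ‖U - V‖ ^ 2 + ⟪w, P.res U V⟫
      + d / 2 * ‖P.res U V‖ ^ 2 + t * (c * ⟪V - U, D⟫ + ⟪w + d • P.res U V, P.constr U D⟫)
      + t ^ 2 * (c / 2 * ‖D‖ ^ 2 + d / 2 * ‖P.constr U D‖ ^ 2)) := by
  have h1 : U - (V + t • D) = (U - V) - t • D := by abel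
  have h2 : ⟪V - U, D⟫ = - ⟪U - V, D⟫ := by rw [← inner_neg_left]; congr 1; abel
  simp only [lag, res_line, h1, h2, norm_sub_sq_real (U - V), norm_add_sq_real (P.res U V),
    inner_add_right, inner_add_left, real_inner_smul_right, real_inner_smul_left, norm_smul,
    mul_pow, Real.norm_eq_abs, sq_abs]
  ring

lemma hasDerivAt_lag (c d : ℝ) (U V D : H) (w : W) :
    HasDerivAt (fun t : ℝ => P.lag c d U (V + t • D) w)
      ⟪P.lagGrad c U V (w + d • P.res U V), D⟫ 0 := by
  have key : ∀ a b e : ℝ, HasDerivAt (fun t : ℝ => a + t * b + t ^ 2 * e) b 0 := fun a b e => by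
    exact ((((hasDerivAt_id (0 : ℝ)).mul_const b).const_add a).add
      (((hasDerivAt_id (0 : ℝ)).pow 2).mul_const e)).congr_deriv (by simp)
  have h := (P.hasDerivAt_obj U V D).add (key
    (c / 2 * ‖U - V‖ ^ 2 + ⟪w, P.res U V⟫ + d / 2 * ‖P.res U V‖ ^ 2)
    (c * ⟪V - U, D⟫ + ⟪w + d • P.res U V, P.constr U D⟫)
    (c / 2 * ‖D‖ ^ 2 + d / 2 * ‖P.constr U D‖ ^ 2))
  rw [inner_lagGrad]
  refine (h.congr_deriv (by ring)).congr_of_eventuallyEq (Filter.Eventually.of_forall fun t => ?_)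
  simp only [lag_line, Pi.add_apply]

/-- Strong convexity of the augmented Lagrangian in the second factor. -/
lemma lag_lower (c d : ℝ) (hd : 0 ≤ d) (U V V' : H) (w : W) :
    P.lag c d U V w + ⟪P.lagGrad c U V (w + d • P.res U V), V' - V⟫ + c / 2 * ‖V' - V‖ ^ 2
      ≤ P.lag c d U V' w := by
  have h := P.lag_line c d U V (V' - V) w 1
  have ho := P.obj_lower U V V'
  simp only [one_smul, add_sub_cancel] at h
  rw [h, inner_lagGrad]
  have : 0 ≤ d / 2 * ‖P.constr U (V' - V)‖ ^ 2 := by positivity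
  simp only [lag]
  linarith

lemma lagGrad_eq_zero_of_forall_le {c d : ℝ} {U V : H} {w : W}
    (h : ∀ V', P.lag c d U V w ≤ P.lag c d U V' w) :
    P.lagGrad c U V (w + d • P.res U V) = 0 := by
  have hd := P.hasDerivAt_lag c d U V (P.lagGrad c U V (w + d • P.res U V)) w
  have hm : IsLocalMin (fun t : ℝ =>
      P.lag c d U (V + t • P.lagGrad c U V (w + d • P.res U V)) w) 0 :=
    Filter.Eventually.of_forall fun t => by simpa using h _
  exact inner_self_eq_zero.mp (hm.hasDerivAt_eq_zero hd)

lemma lag_add_le_of_forall_le {c d : ℝ} (hd : 0 ≤ d) {U V : H} {w : W}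
    (h : ∀ Y, P.lag c d U V w ≤ P.lag c d U Y w) (Y : H) :
    P.lag c d U V w + c / 2 * ‖Y - V‖ ^ 2 ≤ P.lag c d U Y w := by
  simpa [P.lagGrad_eq_zero_of_forall_le h] using P.lag_lower c d hd U V Y w

/-- Objective with the proximity term. -/
def prox (c : ℝ) (U V : H) : ℝ := P.obj U V + c / 2 * ‖U - V‖ ^ 2

lemma lag_eq (c d : ℝ) (U V : H) (w : W) :
    P.lag c d U V w = P.prox c U V + ⟪w, P.res U V⟫ + d / 2 * ‖P.res U V‖ ^ 2 := rfl

lemma prox_symm (c : ℝ) (U V : H) : P.prox c U V = P.prox c V U := by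
  simp only [prox, P.obj_symm U V, norm_sub_rev U V]

lemma three_point {c : ℝ} {U V : H} {w : W} (h : P.lagGrad c U V w = 0) (V' : H) :
    P.prox c U V + ⟪w, P.res U V⟫ + c / 2 * ‖V' - V‖ ^ 2
      ≤ P.prox c U V' + ⟪w, P.res U V'⟫ := by
  have := P.lag_lower c 0 le_rfl U V V' w
  simpa [lag_eq, h] using this

lemma lag_gauge (c d : ℝ) {t : ℝ} (ht : t ≠ 0) (U V : H) :
    P.lag c d (t • U) (t⁻¹ • V) 0 = P.lag c d U V 0
      + c / 2 * (t ^ 2 * ‖U‖ ^ 2 + (t⁻¹) ^ 2 * ‖V‖ ^ 2 - ‖U‖ ^ 2 - ‖V‖ ^ 2) := by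
  simp only [lag_zero, P.obj_gauge t U V ht, P.res_gauge ht, norm_sub_sq_real, norm_smul, mul_pow,
    real_inner_smul_left, real_inner_smul_right, Real.norm_eq_abs, sq_abs]
  field_simp
  ring

/-- Constants for which the alternating scheme stays in the compact sublevel set. -/
structure Regime where
  γ : ℝ
  ρ : ℝ
  ρ₀ : ℝ
  δ : ℝ
  η : ℝ
  Lf : ℝ
  a₁ : ℝ
  a₂ : ℝ
  s : ℝ
  M : ℝ
  ω : ℝ
  β0 : ℝ
  βhat : ℝ
  rho0_pos : 0 < ρ₀
  rho0_lt : ρ₀ < γ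
  two_rho0_lt : 2 * ρ₀ < ρ
  delta_pos : 0 < δ
  eta_pos : 0 < η
  Lf_nonneg : 0 ≤ Lf
  a₁_nonneg : 0 ≤ a₁
  a₂_nonneg : 0 ≤ a₂
  s_nonneg : 0 ≤ s
  M_nonneg : 0 ≤ M
  level_compact : IsCompact {p : H × H | P.lag ρ₀ ρ₀ p.1 p.2 0 ≤ βhat}
  norm_le : ∀ U V, P.lag ρ₀ ρ₀ U V 0 ≤ βhat → ‖U‖ ≤ δ
  le_adj : ∀ U V, P.lag ρ₀ ρ₀ U V 0 ≤ βhat → ∀ w, η * ‖w‖ ≤ ‖P.adj U w‖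
  grad_bound : ∀ U V, ‖U‖ * ‖V‖ ≤ δ ^ 2 → ‖P.partialGrad U V‖ ≤ Lf * ‖U‖
  grad_lip : ∀ U V U' V', ‖U‖ ≤ δ → ‖U'‖ ≤ δ → ‖U‖ * ‖V‖ ≤ δ ^ 2 → ‖U'‖ * ‖V'‖ ≤ δ ^ 2 →
    ‖P.partialGrad U' V' - P.partialGrad U V‖ ≤ a₁ * ‖U' - U‖ + a₂ * ‖V' - V‖
  adj_bound : ∀ U w, ‖P.adj U w‖ ≤ s * ‖U‖ * ‖w‖
  eta_M : Lf * δ + 2 * γ * δ = η * M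
  M_sq_lt : M ^ 2 < ρ * (βhat - β0)
  first_weight : 2 * (a₁ + γ + s * M) ^ 2 ≤ η ^ 2 * (ω * ρ)
  second_weight : 2 * (a₂ + γ) ^ 2 ≤ η ^ 2 * (ω * ρ)
  ω_lt : ω < γ / 2

namespace Regime

variable {P} (R : Regime P)

lemma gamma_pos : 0 < R.γ := R.rho0_pos.trans R.rho0_lt

lemma rho_pos : 0 < R.ρ := by linarith [R.two_rho0_lt, R.rho0_pos]

/-- Membership in the initial sublevel set. -/
def Level (U V : H) : Prop := P.lag R.ρ₀ R.ρ₀ U V 0 ≤ R.βhat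

/-- First factors admitting a partner in the stronger sublevel set. -/
def feasible : Set H := {U | ∃ V, P.lag R.γ R.ρ U V 0 ≤ R.βhat}

variable {R}

lemma level_of_lag_le {U V : H} (h : P.lag R.γ R.ρ U V 0 ≤ R.βhat) : R.Level U V :=
  (P.lag_zero_mono R.rho0_lt.le (by linarith [R.two_rho0_lt, R.rho0_pos]) U V).trans h

lemma Level.symm {U V : H} (h : R.Level U V) : R.Level V U := by
  rwa [Level, P.lag_symm] at h

lemma Level.norm_left {U V : H} (h : R.Level U V) : ‖U‖ ≤ R.δ := R.norm_le U V h

lemma Level.norm_right {U V : H} (h : R.Level U V) : ‖V‖ ≤ R.δ := h.symm.norm_left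

lemma isCompact_sublevel : IsCompact {p : H × H | P.lag R.γ R.ρ p.1 p.2 0 ≤ R.βhat} :=
  R.level_compact.of_isClosed_subset
    (isClosed_le (P.continuous_lag R.γ R.ρ 0) continuous_const) fun _ hp => level_of_lag_le hp

lemma isClosed_feasible : IsClosed R.feasible := by
  have : R.feasible = Prod.fst '' {p : H × H | P.lag R.γ R.ρ p.1 p.2 0 ≤ R.βhat} := by
    ext U; simp [feasible]
  rw [this]
  exact (R.isCompact_sublevel.image continuous_fst).isClosed

variable (R)

/-- `V` is the best partner of `U` for the penalized objective, at an admissible level. -/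
structure BestPartner (U V : H) : Prop where
  le : P.lag R.γ R.ρ U V 0 ≤ R.βhat
  min : ∀ Y, P.lag R.γ R.ρ U V 0 ≤ P.lag R.γ R.ρ U Y 0

/-- A stationary second factor for an admissible first factor. -/
structure Good (U V : H) (w : W) : Prop where
  stat : P.lagGrad R.γ U V w = 0
  mem : ∃ V', R.Level U V'
  sum_le : ‖U‖ + ‖V‖ ≤ 2 * R.δ

variable {R}

lemma exists_bestPartner {U : H} (h : U ∈ R.feasible) : ∃ V, R.BestPartner U V := by
  obtain ⟨V₀, hV₀⟩ := h
  have hc : IsCompact ({p : H × H | P.lag R.γ R.ρ p.1 p.2 0 ≤ R.βhat} ∩ {p | p.1 = U}) :=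
    R.isCompact_sublevel.inter_right (isClosed_eq continuous_fst continuous_const)
  obtain ⟨⟨U', V⟩, ⟨hp, rfl⟩, hmin⟩ := hc.exists_isMinOn ⟨(U, V₀), hV₀, rfl⟩
    (P.continuous_lag R.γ R.ρ 0).continuousOn
  refine ⟨V, hp, fun V' => ?_⟩
  by_cases hV' : P.lag R.γ R.ρ U' V' 0 ≤ R.βhat
  · exact hmin (show (U', V') ∈ _ from ⟨hV', rfl⟩)
  · exact le_trans hp (not_le.mp hV').le

lemma BestPartner.good {U V : H} (h : R.BestPartner U V) : R.Good U V (R.ρ • P.res U V) := by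
  have hl := R.level_of_lag_le h.le
  refine ⟨?_, ⟨V, hl⟩, by linarith [hl.norm_left, hl.norm_right]⟩
  simpa using P.lagGrad_eq_zero_of_forall_le h.min

lemma Good.norm_le {U V : H} {w : W} (h : R.Good U V w) : ‖U‖ ≤ R.δ := by
  obtain ⟨V', hV'⟩ := h.mem
  exact hV'.norm_left

lemma Good.le_adj {U V : H} {w : W} (h : R.Good U V w) (w' : W) :
    R.η * ‖w'‖ ≤ ‖P.adj U w'‖ := by
  obtain ⟨V', hV'⟩ := h.mem
  exact R.le_adj U V' hV' w'

lemma Good.mul_le {U V : H} {w : W} (h : R.Good U V w) : ‖U‖ * ‖V‖ ≤ R.δ ^ 2 := by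
  nlinarith [h.sum_le, norm_nonneg U, norm_nonneg V, sq_nonneg (‖U‖ - ‖V‖), R.delta_pos]

/-- Bound on multipliers of stationary points, for any proximity weight at most `γ`. -/
lemma norm_multiplier_le {c : ℝ} {U V : H} {w : W} (hc0 : 0 ≤ c) (hc : c ≤ R.γ)
    (hst : P.lagGrad c U V w = 0) (hU : ‖U‖ ≤ R.δ) (hsum : ‖U‖ + ‖V‖ ≤ 2 * R.δ)
    (hadj : R.η * ‖w‖ ≤ ‖P.adj U w‖) : ‖w‖ ≤ R.M := by
  have hprod : ‖U‖ * ‖V‖ ≤ R.δ ^ 2 := by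
    nlinarith [norm_nonneg U, norm_nonneg V, sq_nonneg (‖U‖ - ‖V‖), R.delta_pos]
  have h1 : P.adj U w = -(P.partialGrad U V + c • (V - U)) := by
    rw [lagGrad] at hst
    exact (neg_eq_of_add_eq_zero_right hst).symm
  have h2 : ‖P.adj U w‖ ≤ R.Lf * ‖U‖ + c * (‖U‖ + ‖V‖) := by
    rw [h1, norm_neg]
    refine (norm_add_le _ _).trans (add_le_add (R.grad_bound U V hprod) ?_)
    rw [norm_smul, Real.norm_of_nonneg hc0]
    gcongr
    rw [add_comm]; exact norm_sub_le V U
  have h3 : R.Lf * ‖U‖ ≤ R.Lf * R.δ := mul_le_mul_of_nonneg_left hU R.Lf_nonneg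
  have h4 : c * (‖U‖ + ‖V‖) ≤ R.γ * (2 * R.δ) := by
    gcongr
    exact R.gamma_pos.le
  have h5 := R.eta_M
  exact le_of_mul_le_mul_left (by linarith) R.eta_pos

lemma Good.norm_mult_le {U V : H} {w : W} (h : R.Good U V w) : ‖w‖ ≤ R.M :=
  norm_multiplier_le R.gamma_pos.le le_rfl h.stat h.norm_le h.sum_le (h.le_adj w)

/-- Dual increments are controlled by primal increments between stationary points. -/
lemma Good.norm_sub_sq_le {U V U' V' : H} {w w' : W} (h : R.Good U V w) (h' : R.Good U' V' w') :
    ‖w' - w‖ ^ 2 ≤ R.ω * R.ρ * (‖U' - U‖ ^ 2 + ‖V' - V‖ ^ 2) := by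
  have e : P.adj U' (w' - w) = -(P.partialGrad U' V' - P.partialGrad U V)
      - R.γ • (V' - V) + R.γ • (U' - U) - P.adj (U' - U) w := by
    have e1 := h.stat
    have e2 := h'.stat
    rw [lagGrad] at e1 e2
    have : P.adj U' (w' - w) - (-(P.partialGrad U' V' - P.partialGrad U V)
      - R.γ • (V' - V) + R.γ • (U' - U) - P.adj (U' - U) w) =
      (P.partialGrad U' V' + R.γ • (V' - U') + P.adj U' w')
        - (P.partialGrad U V + R.γ • (V - U) + P.adj U w) := by
      simp only [map_sub, LinearMap.sub_apply, smul_sub]; abel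
    rw [e1, e2, sub_zero] at this
    exact sub_eq_zero.mp this
  have hγ := R.gamma_pos
  have n1 : ‖P.adj U' (w' - w)‖ ≤ (R.a₁ * ‖U' - U‖ + R.a₂ * ‖V' - V‖) + R.γ * ‖V' - V‖
      + R.γ * ‖U' - U‖ + R.s * ‖U' - U‖ * R.M := by
    rw [e]
    refine (norm_sub_le _ _).trans (add_le_add ((norm_add_le _ _).trans
      (add_le_add ((norm_sub_le _ _).trans (add_le_add ?_ ?_)) ?_)) ?_)
    · rw [norm_neg]
      exact R.grad_lip U V U' V' h.norm_le h'.norm_le h.mul_le h'.mul_le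
    · rw [norm_smul, Real.norm_of_nonneg hγ.le]
    · rw [norm_smul, Real.norm_of_nonneg hγ.le]
    · refine (R.adj_bound _ _).trans ?_
      have := R.s_nonneg
      gcongr
      exact h.norm_mult_le
  have n2 : R.η * ‖w' - w‖ ≤ (R.a₁ + R.γ + R.s * R.M) * ‖U' - U‖ + (R.a₂ + R.γ) * ‖V' - V‖ := by
    linarith [h'.le_adj (w' - w)]
  have n3 : R.η ^ 2 * ‖w' - w‖ ^ 2
      ≤ R.η ^ 2 * (R.ω * R.ρ * (‖U' - U‖ ^ 2 + ‖V' - V‖ ^ 2)) := by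
    have m1 := mul_le_mul_of_nonneg_right R.first_weight (sq_nonneg ‖U' - U‖)
    have m2 := mul_le_mul_of_nonneg_right R.second_weight (sq_nonneg ‖V' - V‖)
    have m3 := pow_le_pow_left₀ (mul_nonneg R.eta_pos.le (norm_nonneg (w' - w))) n2 2
    have m4 := sq_nonneg ((R.a₁ + R.γ + R.s * R.M) * ‖U' - U‖ - (R.a₂ + R.γ) * ‖V' - V‖)
    linarith
  exact le_of_mul_le_mul_left n3 (pow_pos R.eta_pos 2)

lemma Good.norm_sub_sq_le_half {U V U' V' : H} {w w' : W} (h : R.Good U V w)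
    (h' : R.Good U' V' w') :
    ‖w' - w‖ ^ 2 ≤ R.ρ * (R.γ / 2 * (‖U' - U‖ ^ 2 + ‖V' - V‖ ^ 2)) := by
  refine (h.norm_sub_sq_le h').trans ?_
  have h1 := R.ω_lt
  have h2 := R.rho_pos
  rw [mul_comm R.ω, mul_assoc]
  gcongr

/-- Descent along the segment towards a minimizer in the first factor. -/
lemma lag_segment_le {U U₁ V : H} {w : W}
    (hmin : ∀ U', P.lag R.γ R.ρ U₁ V w ≤ P.lag R.γ R.ρ U' V w) {t : ℝ} (ht : t ∈ Set.Icc (0 : ℝ) 1) :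
    P.lag R.γ R.ρ (U + t • (U₁ - U)) V w + R.γ / 2 * ‖U + t • (U₁ - U) - U‖ ^ 2
      ≤ P.lag R.γ R.ρ U V w := by
  set X := U + t • (U₁ - U) with hX
  have hρ := R.rho_pos.le
  have hγ := R.gamma_pos
  simp only [fun U => P.lag_symm R.γ R.ρ U V w] at hmin ⊢
  set G := P.lagGrad R.γ V X (w + R.ρ • P.res V X)
  have e0 := P.lag_lower R.γ R.ρ hρ V X U w
  have e1 := P.lag_lower R.γ R.ρ hρ V X U₁ w
  have e2 := P.lag_add_le_of_forall_le hρ hmin U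
  have d0 : U - X = (-t) • (U₁ - U) := by rw [hX, neg_smul]; abel
  have d1 : U₁ - X = (1 - t) • (U₁ - U) := by rw [hX, sub_smul, one_smul]; abel
  have d2 : X - U = t • (U₁ - U) := by rw [hX]; abel
  rw [d0, real_inner_smul_right, norm_smul, mul_pow, Real.norm_eq_abs, sq_abs] at e0
  rw [d1, real_inner_smul_right, norm_smul, mul_pow, Real.norm_eq_abs, sq_abs] at e1
  rw [norm_sub_rev] at e2
  rw [d2, norm_smul, mul_pow, Real.norm_eq_abs, sq_abs]
  obtain ⟨t0, t1⟩ := ht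
  have f0 := mul_le_mul_of_nonneg_left e0 (sub_nonneg.mpr t1)
  have f1 := mul_le_mul_of_nonneg_left e1 t0
  have f2 := mul_le_mul_of_nonneg_left e2 t0
  have f3 : 0 ≤ R.γ * (t * (1 - t)) * ‖U₁ - U‖ ^ 2 := by
    have := sub_nonneg.mpr t1
    positivity
  nlinarith

/-- Completing the square in the constraint residual at the best partner. -/
lemma BestPartner.le_lag {X V V' : H} (h : R.BestPartner X V') (w : W) :
    2 * R.ρ * P.lag R.γ R.ρ X V' 0 + ‖R.ρ • P.res X V'‖ ^ 2 + R.ρ * (R.γ * ‖V - V'‖ ^ 2)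
      ≤ 2 * R.ρ * P.lag R.γ R.ρ X V w + ‖w - R.ρ • P.res X V'‖ ^ 2 := by
  have h3 := P.three_point h.good.stat V
  have hρ := R.rho_pos
  have h4 : 0 ≤ ‖w - R.ρ • P.res X V' + R.ρ • P.res X V‖ ^ 2 := sq_nonneg _
  rw [norm_add_sq_real] at h4
  simp only [lag_eq, inner_zero_left, norm_smul, mul_pow, Real.norm_eq_abs, sq_abs,
    real_inner_smul_left, real_inner_smul_right, inner_sub_left, real_inner_self_eq_norm_sq]
    at h3 h4 ⊢
  have h5 := mul_le_mul_of_nonneg_left h3 hρ.le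
  nlinarith

/-- Along the segment to the next iterate the best partner has a controlled level. -/
lemma Good.segment_le {U U₁ V : H} {w : W} (h : R.Good U V w)
    (hmin : ∀ U', P.lag R.γ R.ρ U₁ V w ≤ P.lag R.γ R.ρ U' V w) {t : ℝ} (ht : t ∈ Set.Icc (0 : ℝ) 1)
    {V' : H} (hV' : R.BestPartner (U + t • (U₁ - U)) V') :
    2 * R.ρ * P.lag R.γ R.ρ (U + t • (U₁ - U)) V' 0 + ‖R.ρ • P.res (U + t • (U₁ - U)) V'‖ ^ 2
      + ‖w - R.ρ • P.res (U + t • (U₁ - U)) V'‖ ^ 2 ≤ 2 * R.ρ * P.lag R.γ R.ρ U V w := by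
  have h1 := lag_segment_le (U := U) hmin ht
  have h2 := hV'.le_lag (V := V) w
  have h3 := h.norm_sub_sq_le_half hV'.good
  rw [norm_sub_rev _ w, norm_sub_rev V' V] at h3
  have h4 := mul_le_mul_of_nonneg_left h1 R.rho_pos.le
  linarith

lemma Good.next_mem_feasible {U U₁ V : H} {w : W} (h : R.Good U V w) (hU : U ∈ R.feasible)
    (hL : P.lag R.γ R.ρ U V w < R.βhat)
    (hmin : ∀ U', P.lag R.γ R.ρ U₁ V w ≤ P.lag R.γ R.ρ U' V w) : U₁ ∈ R.feasible := by
  have hcont : Continuous fun t : ℝ => U + t • (U₁ - U) := by fun_prop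
  have hsub : Set.Icc (0 : ℝ) 1 ⊆ (fun t : ℝ => U + t • (U₁ - U)) ⁻¹' R.feasible := by
    refine IsClosed.Icc_subset_of_forall_mem_nhdsWithin ?_ ?_ ?_
    · exact (R.isClosed_feasible.preimage hcont).inter isClosed_Icc
    · simpa using hU
    · rintro t ⟨ht, ht'⟩
      obtain ⟨V', hV'⟩ := R.exists_bestPartner ht
      have hs := h.segment_le hmin (Set.Ico_subset_Icc_self ht') hV'
      have hlt : P.lag R.γ R.ρ (U + t • (U₁ - U)) V' 0 < R.βhat := by
        have := R.rho_pos
        nlinarith [sq_nonneg ‖R.ρ • P.res (U + t • (U₁ - U)) V'‖,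
          sq_nonneg ‖w - R.ρ • P.res (U + t • (U₁ - U)) V'‖]
      have hc : Continuous fun t : ℝ => P.lag R.γ R.ρ (U + t • (U₁ - U)) V' 0 :=
        (P.continuous_lag R.γ R.ρ 0).comp (hcont.prodMk continuous_const)
      refine mem_nhdsWithin_of_mem_nhds ?_
      filter_upwards [hc.continuousAt.eventually_lt continuousAt_const hlt] with x hx
      exact ⟨V', hx.le⟩
  simpa using hsub (Set.right_mem_Icc.mpr zero_le_one)

/-- Rescaling the factors shows that near-critical levels force a gap to the radius `δ`. -/
lemma gauge_gap {U V : H} (hU : U ≠ 0) :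
    R.βhat ≤ P.lag R.ρ₀ R.ρ₀ U V 0
      + R.ρ₀ / 2 * ((R.δ ^ 2 - ‖U‖ ^ 2) * (R.δ ^ 2 - ‖V‖ ^ 2) / R.δ ^ 2) := by
  by_contra! hlt
  have hn : 0 < ‖U‖ := norm_pos_iff.mpr hU
  have hδ := R.delta_pos
  set t₀ := R.δ / ‖U‖ with ht₀
  have ht₀pos : 0 < t₀ := div_pos hδ hn
  have hcont : ContinuousAt (fun t : ℝ => P.lag R.ρ₀ R.ρ₀ (t • U) (t⁻¹ • V) 0) t₀ := by
    refine (P.continuous_lag R.ρ₀ R.ρ₀ 0).continuousAt.comp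
      (f := fun t : ℝ => (t • U, t⁻¹ • V)) ?_
    have : ContinuousAt (fun t : ℝ => t⁻¹) t₀ := continuousAt_inv₀ ht₀pos.ne'
    fun_prop
  have hval : P.lag R.ρ₀ R.ρ₀ (t₀ • U) (t₀⁻¹ • V) 0 < R.βhat := by
    refine lt_of_eq_of_lt ?_ hlt
    rw [P.lag_gauge _ _ ht₀pos.ne', ht₀]
    field_simp
    ring
  have hev := hcont.eventually_lt continuousAt_const hval
  obtain ⟨ε, hε, hball⟩ := Metric.eventually_nhds_iff.mp hev
  have hlt' := hball (y := t₀ + ε / 2) (by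
    rw [Real.dist_eq, add_sub_cancel_left, abs_of_pos (half_pos hε)]; linarith)
  have hle := Level.norm_left (R := R) hlt'.le
  rw [norm_smul, Real.norm_of_nonneg (by positivity), add_mul, ht₀, div_mul_cancel₀ _ hn.ne'] at hle
  have : 0 < ε / 2 * ‖U‖ := by positivity
  linarith

/-- The dual-updated second factor keeps the norm sum below `2δ`. -/
lemma BestPartner.sum_norm_le [Nontrivial W] {U V' V : H} {w : W} (h : R.BestPartner U V')
    (hlev : 8 * R.ρ * P.lag R.γ R.ρ U V' 0 + ‖w‖ ^ 2 ≤ 8 * R.ρ * R.βhat)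
    (hst : P.lagGrad R.γ U V (w + R.ρ • P.res U V) = 0) : ‖U‖ + ‖V‖ ≤ 2 * R.δ := by
  have hρ := R.rho_pos
  have hδ := R.delta_pos
  have hl := R.level_of_lag_le h.le
  have hU : U ≠ 0 := by
    rintro rfl
    obtain ⟨w', hw'⟩ := exists_ne (0 : W)
    have := R.le_adj 0 V' hl w'
    simp only [map_zero, LinearMap.zero_apply, norm_zero] at this
    nlinarith [R.eta_pos, norm_pos_iff.mpr hw']
  have hmono : 4 * (R.ρ * (R.γ * ‖V - V'‖ ^ 2)) ≤ ‖w‖ ^ 2 := by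
    have h1 := P.three_point hst V'
    have h2 := P.three_point h.good.stat V
    have h3 : 0 ≤ ‖w - (2 : ℝ) • (w + R.ρ • P.res U V - R.ρ • P.res U V')‖ ^ 2 := sq_nonneg _
    rw [norm_sub_rev V' V] at h1
    have h4 : ‖w + R.ρ • P.res U V - R.ρ • P.res U V'‖ ^ 2
        - ⟪w, w + R.ρ • P.res U V - R.ρ • P.res U V'⟫
        = R.ρ * ⟪w + R.ρ • P.res U V - R.ρ • P.res U V', P.res U V - P.res U V'⟫ := by
      rw [← real_inner_self_eq_norm_sq, ← inner_sub_left, ← real_inner_smul_right,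
        real_inner_comm, smul_sub]
      congr 1
      abel
    rw [norm_sub_sq_real, norm_smul, mul_pow, Real.norm_eq_abs, sq_abs,
      real_inner_smul_right] at h3
    have h5 : R.γ * ‖V - V'‖ ^ 2
        ≤ -⟪w + R.ρ • P.res U V - R.ρ • P.res U V', P.res U V - P.res U V'⟫ := by
      rw [inner_sub_left, inner_sub_right, inner_sub_right]
      linarith
    have h6 := mul_le_mul_of_nonneg_left h5 hρ.le
    linarith
  by_contra! hgt
  have hgap := R.gauge_gap (V := V') hU
  have hU1 := hl.norm_left
  have hV1 := hl.norm_right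
  have htri : ‖V‖ ≤ ‖V'‖ + ‖V - V'‖ := by
    have := norm_add_le V' (V - V')
    rwa [add_sub_cancel] at this
  have hle : P.lag R.ρ₀ R.ρ₀ U V' 0 ≤ P.lag R.γ R.ρ U V' 0 :=
    P.lag_zero_mono R.rho0_lt.le (by linarith [R.two_rho0_lt, R.rho0_pos]) U V'
  set u := R.δ - ‖U‖ with hu
  set v := R.δ - ‖V'‖ with hv
  have hu0 : 0 ≤ u := sub_nonneg.mpr hU1
  have hv0 : 0 ≤ v := sub_nonneg.mpr hV1
  have huv : u + v < ‖V - V'‖ := by rw [hu, hv]; linarith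
  have hfrac : (R.δ ^ 2 - ‖U‖ ^ 2) * (R.δ ^ 2 - ‖V'‖ ^ 2) / R.δ ^ 2 ≤ 4 * (u * v) := by
    rw [div_le_iff₀ (by positivity)]
    have e1 : R.δ ^ 2 - ‖U‖ ^ 2 = u * (R.δ + ‖U‖) := by rw [hu]; ring
    have e2 : R.δ ^ 2 - ‖V'‖ ^ 2 = v * (R.δ + ‖V'‖) := by rw [hv]; ring
    rw [e1, e2]
    have e3 : (R.δ + ‖U‖) * (R.δ + ‖V'‖) ≤ (2 * R.δ) * (2 * R.δ) := by
      gcongr <;> linarith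
    nlinarith [mul_le_mul_of_nonneg_left e3 (mul_nonneg hu0 hv0)]
  have hsq : 4 * (u * v) < ‖V - V'‖ ^ 2 := by
    nlinarith [sq_nonneg (u - v)]
  have hρ₀ := R.rho0_pos
  have h7 : R.ρ₀ / 2 * ((R.δ ^ 2 - ‖U‖ ^ 2) * (R.δ ^ 2 - ‖V'‖ ^ 2) / R.δ ^ 2)
      < R.γ / 2 * ‖V - V'‖ ^ 2 := by
    have a1 : R.ρ₀ / 2 * ((R.δ ^ 2 - ‖U‖ ^ 2) * (R.δ ^ 2 - ‖V'‖ ^ 2) / R.δ ^ 2)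
      < R.ρ₀ / 2 * ‖V - V'‖ ^ 2 := mul_lt_mul_of_pos_left (hfrac.trans_lt hsq) (by positivity)
    refine a1.trans_le ?_
    gcongr
    exact R.rho0_lt.le
  have h8 : R.βhat < P.lag R.γ R.ρ U V' 0 + R.γ / 2 * ‖V - V'‖ ^ 2 := by linarith
  nlinarith [mul_lt_mul_of_pos_left h8 hρ]

variable (R)

/-- Invariant of the iteration. -/
structure Inv (U V : H) (w : W) : Prop extends R.Good U V w where
  feas : U ∈ R.feasible
  lag_lt : P.lag R.γ R.ρ U V w < R.βhat

/-- One pass of the alternating scheme. -/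
structure Step (U V : H) (w : W) (U₁ V₁ : H) (w₁ : W) : Prop where
  minU : ∀ U', P.lag R.γ R.ρ U₁ V w ≤ P.lag R.γ R.ρ U' V w
  minV : ∀ V', P.lag R.γ R.ρ U₁ V₁ w ≤ P.lag R.γ R.ρ U₁ V' w
  dual : w₁ = w + R.ρ • P.res U₁ V₁

variable {R}

lemma Step.stat {U V U₁ V₁ : H} {w w₁ : W} (hs : R.Step U V w U₁ V₁ w₁) :
    P.lagGrad R.γ U₁ V₁ w₁ = 0 := by
  rw [hs.dual]; exact P.lagGrad_eq_zero_of_forall_le hs.minV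

lemma Step.res_eq {U V U₁ V₁ : H} {w w₁ : W} (hs : R.Step U V w U₁ V₁ w₁) :
    R.ρ • P.res U₁ V₁ = w₁ - w := by
  rw [hs.dual, add_sub_cancel_left]

lemma Step.lag_dual {U V U₁ V₁ : H} {w w₁ : W} (hs : R.Step U V w U₁ V₁ w₁) :
    R.ρ * P.lag R.γ R.ρ U₁ V₁ w₁ = R.ρ * P.lag R.γ R.ρ U₁ V₁ w + ‖w₁ - w‖ ^ 2 := by
  have h1 : ‖w₁ - w‖ ^ 2 = R.ρ * ⟪w₁ - w, P.res U₁ V₁⟫ := by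
    rw [← real_inner_smul_right, hs.res_eq, real_inner_self_eq_norm_sq]
  rw [h1, inner_sub_left, lag_eq, lag_eq]
  ring

lemma Step.lag_primal {U V U₁ V₁ : H} {w w₁ : W} (hs : R.Step U V w U₁ V₁ w₁) :
    P.lag R.γ R.ρ U₁ V₁ w + R.γ / 2 * (‖U₁ - U‖ ^ 2 + ‖V₁ - V‖ ^ 2)
      ≤ P.lag R.γ R.ρ U V w := by
  have h1 := P.lag_add_le_of_forall_le R.rho_pos.le hs.minV V
  have h2 := P.lag_add_le_of_forall_le R.rho_pos.le
    (U := V) (V := U₁) (w := w) (c := R.γ) (d := R.ρ)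
    (by simpa only [P.lag_symm R.γ R.ρ V] using hs.minU) U
  rw [P.lag_symm _ _ V, P.lag_symm _ _ V] at h2
  rw [norm_sub_rev] at h1 h2
  linarith

lemma Good.lag_decrease {U V U₁ V₁ : H} {w w₁ : W} (h : R.Good U V w) (h' : R.Good U₁ V₁ w₁)
    (hs : R.Step U V w U₁ V₁ w₁) :
    P.lag R.γ R.ρ U₁ V₁ w₁ + (R.γ / 2 - R.ω) * (‖U₁ - U‖ ^ 2 + ‖V₁ - V‖ ^ 2)
      ≤ P.lag R.γ R.ρ U V w := by
  have h1 := h.norm_sub_sq_le h'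
  have h2 := hs.lag_dual
  have h3 := hs.lag_primal
  refine le_of_mul_le_mul_left ?_ R.rho_pos
  nlinarith [mul_le_mul_of_nonneg_left h3 R.rho_pos.le]

lemma Inv.step [Nontrivial W] {U V U₁ V₁ : H} {w w₁ : W} (h : R.Inv U V w)
    (hs : R.Step U V w U₁ V₁ w₁) : R.Inv U₁ V₁ w₁ := by
  have hfeas := h.next_mem_feasible h.feas h.lag_lt hs.minU
  obtain ⟨V', hV'⟩ := exists_bestPartner hfeas
  have hseg := h.segment_le hs.minU (t := 1) (by simp) (V' := V') (by simpa using hV')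
  simp only [one_smul, add_sub_cancel] at hseg
  have hst := hs.stat
  have hsum : ‖U₁‖ + ‖V₁‖ ≤ 2 * R.δ := by
    refine hV'.sum_norm_le (w := w) ?_ (hs.dual ▸ hst)
    have htri : ‖w‖ ≤ ‖w - R.ρ • P.res U₁ V'‖ + ‖R.ρ • P.res U₁ V'‖ := by
      have := norm_add_le (w - R.ρ • P.res U₁ V') (R.ρ • P.res U₁ V')
      rwa [sub_add_cancel] at this
    have := pow_le_pow_left₀ (norm_nonneg w) htri 2
    nlinarith [sq_nonneg (‖w - R.ρ • P.res U₁ V'‖ - ‖R.ρ • P.res U₁ V'‖),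
      mul_lt_mul_of_pos_left h.lag_lt R.rho_pos, sq_nonneg ‖w - R.ρ • P.res U₁ V'‖,
      sq_nonneg ‖R.ρ • P.res U₁ V'‖]
  have hgood : R.Good U₁ V₁ w₁ := ⟨hst, ⟨V', level_of_lag_le hV'.le⟩, hsum⟩
  refine { hgood with feas := hfeas, lag_lt := ?_ }
  have := h.toGood.lag_decrease hgood hs
  have hω := sub_pos.mpr R.ω_lt
  have : 0 ≤ (R.γ / 2 - R.ω) * (‖U₁ - U‖ ^ 2 + ‖V₁ - V‖ ^ 2) := by positivity
  linarith [h.lag_lt]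

variable (R)

/-- State reached after the first pass from an admissible initial point. -/
structure Start (U V : H) (w₀ w : W) : Prop where
  stat : P.lagGrad R.γ U V w = 0
  res_eq : R.ρ • P.res U V = w - w₀
  prox_le : 2 * R.ρ * P.prox R.γ U V + ‖w‖ ^ 2 + ‖w₀‖ ^ 2 ≤ 2 * R.ρ * R.β0

variable {R}

lemma Step.start {U V U₁ V₁ : H} {w w₁ : W} (hs : R.Step U V w U₁ V₁ w₁)
    (hinit : P.lag R.γ R.ρ U V w + 1 / R.ρ * ‖w‖ ^ 2 ≤ R.β0) : R.Start U₁ V₁ w w₁ := by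
  refine ⟨hs.stat, hs.res_eq, ?_⟩
  have hρ := R.rho_pos
  have h1 := hs.lag_primal
  have h0 : 0 ≤ R.γ / 2 * (‖U₁ - U‖ ^ 2 + ‖V₁ - V‖ ^ 2) := by have := R.gamma_pos; positivity
  have h2 : P.lag R.γ R.ρ U₁ V₁ w + 1 / R.ρ * ‖w‖ ^ 2 ≤ R.β0 := by linarith
  have h3 : R.ρ * ⟪w, P.res U₁ V₁⟫ = ⟪w, w₁⟫ - ‖w‖ ^ 2 := by
    rw [← real_inner_smul_right, hs.res_eq, inner_sub_right, real_inner_self_eq_norm_sq]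
  have h4 : R.ρ * (R.ρ * ‖P.res U₁ V₁‖ ^ 2) = ‖w₁‖ ^ 2 - 2 * ⟪w, w₁⟫ + ‖w‖ ^ 2 := by
    rw [← real_inner_comm w, ← norm_sub_sq_real, ← hs.res_eq, norm_smul, mul_pow,
      Real.norm_eq_abs, sq_abs]
    ring
  have h5 := mul_le_mul_of_nonneg_left h2 (by positivity : 0 ≤ 2 * R.ρ)
  rw [lag_eq] at h5
  have h6 : 2 * R.ρ * (1 / R.ρ * ‖w‖ ^ 2) = 2 * ‖w‖ ^ 2 := by field_simp
  nlinarith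

lemma beta_lt : R.β0 < R.βhat := by
  have h := R.M_sq_lt
  have : 0 < R.βhat - R.β0 := pos_of_mul_pos_right ((sq_nonneg R.M).trans_lt h) R.rho_pos.le
  linarith

lemma Start.lag_le {U V : H} {w₀ w : W} (h : R.Start U V w₀ w) :
    P.lag R.ρ₀ R.ρ₀ U V 0 ≤ R.β0 := by
  have hρ := R.rho_pos
  have h1 : P.lag R.ρ₀ R.ρ₀ U V 0 ≤ P.lag R.γ (R.ρ / 2) U V 0 :=
    P.lag_zero_mono R.rho0_lt.le (by linarith [R.two_rho0_lt]) U V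
  have h2 : R.ρ * (R.ρ * ‖P.res U V‖ ^ 2) ≤ 2 * ‖w‖ ^ 2 + 2 * ‖w₀‖ ^ 2 := by
    have e : R.ρ * (R.ρ * ‖P.res U V‖ ^ 2) = ‖w - w₀‖ ^ 2 := by
      rw [← h.res_eq, norm_smul, mul_pow, Real.norm_eq_abs, sq_abs]; ring
    have := pow_le_pow_left₀ (norm_nonneg _) (norm_sub_le w w₀) 2
    nlinarith [sq_nonneg (‖w‖ - ‖w₀‖)]
  rw [P.lag_eq R.γ, inner_zero_left] at h1
  refine le_of_mul_le_mul_left ?_ (by positivity : 0 < 2 * R.ρ)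
  nlinarith [h.prox_le, mul_le_mul_of_nonneg_left h1 hρ.le]

lemma Start.level {U V : H} {w₀ w : W} (h : R.Start U V w₀ w) : R.Level U V :=
  h.lag_le.trans beta_lt.le

lemma Start.good {U V : H} {w₀ w : W} (h : R.Start U V w₀ w) : R.Good U V w :=
  ⟨h.stat, ⟨V, h.level⟩, by linarith [h.level.norm_left, h.level.norm_right]⟩

lemma inner_le_M_sq {a l : W} (ha : ‖a‖ ≤ R.M) (hl : ‖l‖ ≤ R.M) : ⟪a, l⟫ ≤ R.M ^ 2 := by
  rw [sq]
  exact (real_inner_le_norm a l).trans (mul_le_mul ha hl (norm_nonneg _) R.M_nonneg)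

/-- A point satisfying the mixed optimality system lies strictly inside the sublevel set. -/
lemma Start.lag_lt_of_mixed {U V Z : H} {w₀ l : W} (h : R.Start U V w₀ l) (hZ : R.Level V Z)
    {τ : ℝ} (hτ : 0 ≤ τ)
    (hmix : P.lagGrad R.γ V Z (l + R.ρ • P.res V Z)
      + τ • P.lagGrad R.ρ₀ V Z (R.ρ₀ • P.res V Z) = 0) :
    P.lag R.ρ₀ R.ρ₀ V Z 0 < R.βhat := by
  have hρ := R.rho_pos
  have hτ1 : 0 < 1 + τ := by linarith
  set s := (1 + τ)⁻¹ with hs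
  have hs0 : 0 ≤ s := by positivity
  have hs1 : s ≤ 1 := inv_le_one_of_one_le₀ (by linarith)
  have hsτ : s * τ = 1 - s := by rw [hs]; field_simp; ring
  set θ := R.ρ₀ / R.ρ with hθ
  have hθ0 : 0 ≤ θ := div_nonneg R.rho0_pos.le hρ.le
  have hθ1 : θ ≤ 1 := by
    rw [hθ, div_le_one hρ]; linarith [R.two_rho0_lt, R.rho0_pos]
  have hθρ : θ * R.ρ = R.ρ₀ := div_mul_cancel₀ _ hρ.ne'
  set r := P.res V Z with hr
  set z := R.ρ • r with hz
  set a := s • l + (s + (1 - s) * θ) • z with ha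
  set c := R.γ * s + R.ρ₀ * (1 - s) with hc
  have hc1 : R.ρ₀ ≤ c := by nlinarith [R.rho0_lt]
  have hc2 : c ≤ R.γ := by nlinarith [R.rho0_lt]
  have hst : P.lagGrad c V Z a = 0 := by
    have hz' : R.ρ₀ • r = θ • z := by rw [hz, smul_smul, hθρ]
    have key : P.lagGrad c V Z a = s • (P.lagGrad R.γ V Z (l + z)
        + τ • P.lagGrad R.ρ₀ V Z (R.ρ₀ • r)) := by
      rw [hz']
      simp only [lagGrad, ha, hc, smul_add, smul_smul, hsτ, map_add, map_smul, ← mul_assoc]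
      module
    rw [key, hmix, smul_zero]
  have haM : ‖a‖ ≤ R.M := norm_multiplier_le (R.rho0_pos.le.trans hc1) hc2 hst hZ.norm_left
    (by linarith [hZ.norm_left, hZ.norm_right]) (R.le_adj V Z hZ a)
  have hal := R.inner_le_M_sq haM h.good.norm_mult_le
  have h3 := P.three_point hst U
  have hp1 : P.prox R.ρ₀ V Z ≤ P.prox c V Z := by unfold prox; gcongr
  have hp2 : P.prox c V U ≤ P.prox R.γ V U := by unfold prox; gcongr
  have hp3 : P.prox R.γ V U = P.prox R.γ U V := P.prox_symm _ _ _
  have hcomb := combination_sq_le (l := l) (z := z) hs0 hs1 hθ0 hθ1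
  rw [← ha] at hcomb
  have hr1 : R.ρ * ⟪a, P.res V U⟫ = ⟪a, l⟫ - ⟪a, w₀⟫ := by
    rw [← real_inner_smul_right, P.res_symm V U, h.res_eq, inner_sub_right]
  have hr2 : R.ρ * ⟪a, r⟫ = ⟪a, z⟫ := by rw [← real_inner_smul_right]
  have hr3 : R.ρ * (R.ρ₀ * ‖r‖ ^ 2) = θ * ‖z‖ ^ 2 := by
    rw [hz, norm_smul, mul_pow, Real.norm_eq_abs, sq_abs, ← hθρ]; ring
  have hw0 : 0 ≤ ‖a + w₀‖ ^ 2 := sq_nonneg _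
  rw [norm_add_sq_real] at hw0
  have hcpos : 0 ≤ c / 2 * ‖U - Z‖ ^ 2 := by have := R.rho0_pos.le.trans hc1; positivity
  have h4 : P.prox R.ρ₀ V Z + ⟪a, r⟫ ≤ P.prox R.γ U V + ⟪a, P.res V U⟫ := by linarith
  have h5 := mul_le_mul_of_nonneg_left h4 hρ.le
  rw [lag_eq, inner_zero_left, ← hr]
  have h6 := R.M_sq_lt
  have h7 := h.prox_le
  refine lt_of_mul_lt_mul_left (a := 2 * R.ρ) ?_ (by positivity)
  linarith

open Filter Topology in
/-- The minimizer over the first factor stays in the initial sublevel set. -/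
lemma Start.level_next {U V U₂ : H} {w₀ l : W} (h : R.Start U V w₀ l)
    (hmin : ∀ U', P.lag R.γ R.ρ U₂ V l ≤ P.lag R.γ R.ρ U' V l) : R.Level U₂ V := by
  have hρ := R.rho_pos
  have hc : IsCompact ({p : H × H | P.lag R.ρ₀ R.ρ₀ p.1 p.2 0 ≤ R.βhat} ∩ {p | p.1 = V}) :=
    R.level_compact.inter_right (isClosed_eq continuous_fst continuous_const)
  obtain ⟨⟨V, Z⟩, ⟨hZ, rfl⟩, hZmin⟩ := hc.exists_isMinOn ⟨(V, U), h.level.symm, rfl⟩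
    (P.continuous_lag R.γ R.ρ l).continuousOn
  replace hZ : R.Level V Z := hZ
  replace hZmin : ∀ Z', R.Level V Z' → P.lag R.γ R.ρ V Z l ≤ P.lag R.γ R.ρ V Z' l :=
    fun Z' hZ' => hZmin (show (V, Z') ∈ _ from ⟨hZ', rfl⟩)
  have hS := P.hasDerivAt_lag R.ρ₀ R.ρ₀ V Z
  have hQ := P.hasDerivAt_lag R.γ R.ρ V Z
  have hlt : P.lag R.ρ₀ R.ρ₀ V Z 0 < R.βhat := by
    by_contra! hge
    have hp : P.lagGrad R.ρ₀ V Z (0 + R.ρ₀ • P.res V Z) ≠ 0 := fun h0 => by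
      have h1 := P.lag_lower R.ρ₀ R.ρ₀ R.rho0_pos.le V Z U 0
      have h2 := h.lag_le
      rw [h0, inner_zero_left, P.lag_symm _ _ V U] at h1
      have : 0 ≤ R.ρ₀ / 2 * ‖U - Z‖ ^ 2 := by have := R.rho0_pos; positivity
      linarith [R.beta_lt]
    obtain ⟨τ, hτ, hmix⟩ := exists_add_smul_eq_zero_of_forall_inner hp
      (q := P.lagGrad R.γ V Z (l + R.ρ • P.res V Z)) fun D hD => by
        refine nonneg_of_hasDerivAt_of_eventually_ge (hQ D l) ?_
        filter_upwards [eventually_lt_of_hasDerivAt_neg (hS D 0) hD] with t ht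
        simp only [zero_smul, add_zero] at ht ⊢
        exact hZmin _ (ht.le.trans hZ)
    rw [zero_add] at hmix
    exact (h.lag_lt_of_mixed hZ hτ hmix).not_ge hge
  have hstat : P.lagGrad R.γ V Z (l + R.ρ • P.res V Z) = 0 := by
    set q := P.lagGrad R.γ V Z (l + R.ρ • P.res V Z)
    have hcont : Continuous fun t : ℝ => P.lag R.ρ₀ R.ρ₀ V (Z + t • q) 0 :=
      (P.continuous_lag R.ρ₀ R.ρ₀ 0).comp (by fun_prop : Continuous fun t : ℝ => (V, Z + t • q))
    have hev : ∀ᶠ t in 𝓝 (0 : ℝ), P.lag R.ρ₀ R.ρ₀ V (Z + t • q) 0 < R.βhat :=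
      hcont.continuousAt.eventually_lt continuousAt_const (by simpa using hlt)
    have hloc : IsLocalMin (fun t : ℝ => P.lag R.γ R.ρ V (Z + t • q) l) 0 := by
      filter_upwards [hev] with t ht
      simpa using hZmin _ ht.le
    exact inner_self_eq_zero.mp (hloc.hasDerivAt_eq_zero (hQ q l))
  have h1 := P.lag_lower R.γ R.ρ hρ.le V Z U₂ l
  have h2 := hmin Z
  rw [hstat, inner_zero_left, P.lag_symm _ _ V U₂] at h1
  rw [P.lag_symm _ _ Z V] at h2
  have hγ := R.gamma_pos
  have h3 : ‖U₂ - Z‖ ^ 2 ≤ 0 := by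
    have : R.γ / 2 * ‖U₂ - Z‖ ^ 2 ≤ 0 := by linarith
    nlinarith
  have h4 : U₂ = Z := sub_eq_zero.mp
    (norm_eq_zero.mp (pow_eq_zero_iff two_ne_zero |>.mp (le_antisymm h3 (sq_nonneg _))))
  rw [h4]
  exact hZ.symm

/-- The second pass lands in the invariant region. -/
lemma Start.inv [Nontrivial W] {U V U₂ V₂ : H} {w₀ l c : W} (h : R.Start U V w₀ l)
    (hs : R.Step U V l U₂ V₂ c) : R.Inv U₂ V₂ c := by
  have hρ := R.rho_pos
  have hγ := R.gamma_pos
  have hlev := h.level_next hs.minU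
  set a := l + R.ρ • P.res U₂ V with ha
  have hra : R.ρ • P.res U₂ V = a - l := by rw [ha, add_sub_cancel_left]
  have hst : P.lagGrad R.γ V U₂ a = 0 := by
    rw [ha, P.res_symm]
    refine P.lagGrad_eq_zero_of_forall_le fun U' => ?_
    simpa only [P.lag_symm _ _ V] using hs.minU U'
  have haM : ‖a‖ ≤ R.M := norm_multiplier_le hγ.le le_rfl hst hlev.norm_right
    (by linarith [hlev.norm_left, hlev.norm_right]) (R.le_adj V U₂ hlev.symm a)
  have hlM := h.good.norm_mult_le
  have hal := R.inner_le_M_sq haM hlM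
  have hM := R.M_sq_lt
  have hpl := h.prox_le
  have hw0 : 0 ≤ ‖a + w₀‖ ^ 2 := sq_nonneg _
  rw [norm_add_sq_real] at hw0
  have h1 : R.ρ * P.prox R.γ U₂ V + (‖a‖ ^ 2 - ⟪a, l⟫) + R.ρ * (R.γ / 2 * ‖U₂ - U‖ ^ 2)
      ≤ R.ρ * P.prox R.γ U V + (⟪a, l⟫ - ⟪a, w₀⟫) := by
    have h3 := mul_le_mul_of_nonneg_left (P.three_point hst U) hρ.le
    have e1 : R.ρ * ⟪a, P.res V U⟫ = ⟪a, l⟫ - ⟪a, w₀⟫ := by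
      rw [← real_inner_smul_right, P.res_symm V U, h.res_eq, inner_sub_right]
    have e2 : R.ρ * ⟪a, P.res V U₂⟫ = ‖a‖ ^ 2 - ⟪a, l⟫ := by
      rw [← real_inner_smul_right, P.res_symm V U₂, hra, inner_sub_right,
        real_inner_self_eq_norm_sq]
    rw [norm_sub_rev U, P.prox_symm _ V U₂, P.prox_symm _ V U] at h3
    linarith
  have hr2 : R.ρ * (R.ρ * ‖P.res U₂ V‖ ^ 2) = ‖a - l‖ ^ 2 := by
    rw [← hra, norm_smul, mul_pow, Real.norm_eq_abs, sq_abs]; ring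
  have hdU : 0 ≤ R.ρ * (R.γ / 2 * ‖U₂ - U‖ ^ 2) := by positivity
  have hfeas : U₂ ∈ R.feasible := by
    refine ⟨V, le_of_mul_le_mul_left ?_ (by positivity : 0 < 2 * R.ρ)⟩
    rw [lag_eq, inner_zero_left]
    rw [norm_sub_sq_real] at hr2
    linarith
  obtain ⟨V', hV'⟩ := exists_bestPartner hfeas
  have hbest : 8 * R.ρ * P.lag R.γ R.ρ U₂ V' 0 + ‖l‖ ^ 2 ≤ 8 * R.ρ * R.βhat := by
    set μ := R.ρ • P.res U₂ V' with hμ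
    have h2 := mul_le_mul_of_nonneg_left (P.three_point hV'.good.stat V) hρ.le
    have h3 := h.good.norm_sub_sq_le_half hV'.good
    rw [← hμ] at h2 h3
    have e1 : R.ρ * ⟪μ, P.res U₂ V⟫ = ⟪μ, a⟫ - ⟪μ, l⟫ := by
      rw [← real_inner_smul_right, hra, inner_sub_right]
    have e2 : R.ρ * ⟪μ, P.res U₂ V'⟫ = ‖μ‖ ^ 2 := by
      rw [← real_inner_smul_right, ← hμ, real_inner_self_eq_norm_sq]
    have e3 : R.ρ * (R.ρ * ‖P.res U₂ V'‖ ^ 2) = ‖μ‖ ^ 2 := by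
      rw [hμ, norm_smul, mul_pow, Real.norm_eq_abs, sq_abs]; ring
    have s1 : 0 ≤ ‖(3 : ℝ) • μ - (a + l)‖ ^ 2 := sq_nonneg _
    have s2 : 0 ≤ ‖(5 : ℝ) • a - (7 : ℝ) • l‖ ^ 2 := sq_nonneg _
    have ha2 := pow_le_pow_left₀ (norm_nonneg a) haM 2
    have hl2 := pow_le_pow_left₀ (norm_nonneg l) hlM 2
    rw [lag_eq, inner_zero_left]
    simp only [norm_sub_sq_real, norm_add_sq_real, norm_smul, mul_pow, Real.norm_eq_abs, sq_abs,
      inner_add_right, real_inner_smul_left, real_inner_smul_right] at s1 s2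
    rw [norm_sub_sq_real μ] at h3
    rw [norm_sub_rev V] at h2
    linarith [sq_nonneg ‖l‖]
  have hgood : R.Good U₂ V₂ c :=
    ⟨hs.stat, ⟨V, hlev⟩, hV'.sum_norm_le hbest (hs.dual ▸ hs.stat)⟩
  refine { hgood with feas := hfeas, lag_lt := ?_ }
  have h2 := mul_le_mul_of_nonneg_left (P.three_point hs.stat V) hρ.le
  have h3 := h.good.norm_sub_sq_le_half hgood
  have e1 : R.ρ * ⟪c, P.res U₂ V⟫ = ⟪c, a⟫ - ⟪c, l⟫ := by
    rw [← real_inner_smul_right, hra, inner_sub_right]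
  have e3 : R.ρ * (R.ρ * ‖P.res U₂ V₂‖ ^ 2) = ‖c - l‖ ^ 2 := by
    rw [← hs.res_eq, norm_smul, mul_pow, Real.norm_eq_abs, sq_abs]; ring
  have s1 : 0 ≤ ‖c - a‖ ^ 2 := sq_nonneg _
  have s2 : 0 ≤ ‖a - l‖ ^ 2 := sq_nonneg _
  have ha2 := pow_le_pow_left₀ (norm_nonneg a) haM 2
  rw [lag_eq]
  rw [norm_sub_rev V] at h2
  rw [norm_sub_sq_real] at e3 h3 s1 s2
  refine lt_of_mul_lt_mul_left (a := 2 * R.ρ) ?_ (by positivity)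
  nlinarith

lemma norm_constr_le (U V : H) : ‖P.constr U V‖ ≤ R.s * ‖U‖ * ‖V‖ := by
  rcases (norm_nonneg (P.constr U V)).eq_or_lt with h0 | hpos
  · rw [← h0]
    have := R.s_nonneg
    positivity
  · refine le_of_mul_le_mul_right ?_ hpos
    calc ‖P.constr U V‖ * ‖P.constr U V‖ = ⟪P.adj U (P.constr U V), V⟫ := by
          rw [P.inner_adj, real_inner_self_eq_norm_mul_norm]
      _ ≤ ‖P.adj U (P.constr U V)‖ * ‖V‖ := real_inner_le_norm _ _
      _ ≤ (R.s * ‖U‖ * ‖P.constr U V‖) * ‖V‖ := by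
          gcongr
          exact R.adj_bound _ _
      _ = R.s * ‖U‖ * ‖V‖ * ‖P.constr U V‖ := by ring

lemma Good.norm_right_le {U V : H} {w : W} (h : R.Good U V w) : ‖V‖ ≤ 2 * R.δ := by
  linarith [h.sum_le, norm_nonneg U]

lemma omega_rho_nonneg : 0 ≤ R.ω * R.ρ :=
  nonneg_of_mul_nonneg_right ((by positivity : 0 ≤ 2 * (R.a₂ + R.γ) ^ 2).trans R.second_weight)
    (pow_pos R.eta_pos 2)

lemma Good.norm_dual_sub_le {U V U' V' : H} {w w' : W} (h : R.Good U V w)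
    (h' : R.Good U' V' w') :
    ‖w' - w‖ ≤ Real.sqrt (R.ω * R.ρ) * (‖U' - U‖ + ‖V' - V‖) := by
  have h1 := h.norm_sub_sq_le h'
  refine abs_le_of_sq_le_sq' ?_ (by positivity) |>.2
  rw [mul_pow, Real.sq_sqrt R.omega_rho_nonneg]
  refine h1.trans (mul_le_mul_of_nonneg_left ?_ R.omega_rho_nonneg)
  nlinarith [mul_nonneg (norm_nonneg (U' - U)) (norm_nonneg (V' - V))]

variable (R)

/-- The optimality residuals after one pass are controlled by the size of the pass. -/
lemma exists_residual_le : ∃ C : ℝ, 0 < C ∧ ∀ U V U₁ V₁ w w₁, R.Good U V w → R.Good U₁ V₁ w₁ →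
    R.Step U V w U₁ V₁ w₁ →
    ‖P.lagGrad R.γ V₁ U₁ w₁‖ ≤ C * (‖U₁ - U‖ + ‖V₁ - V‖) ∧
    ‖P.lagGrad R.γ V₁ U₁ (w₁ + R.ρ • P.res U₁ V₁)‖ ≤ C * (‖U₁ - U‖ + ‖V₁ - V‖) ∧
    ‖P.lagGrad R.γ U₁ V₁ (w₁ + R.ρ • P.res U₁ V₁)‖ ≤ C * (‖U₁ - U‖ + ‖V₁ - V‖) ∧
    ‖P.res U₁ V₁‖ ≤ C * (‖U₁ - U‖ + ‖V₁ - V‖) ∧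
    ‖w₁ - w‖ ≤ C * (‖U₁ - U‖ + ‖V₁ - V‖) := by
  obtain ⟨K, hK0, hK⟩ := P.partialGrad_locally_lipschitz (2 * R.δ)
  have hs := R.s_nonneg
  have hδ := R.delta_pos
  have hρ := R.rho_pos
  have hγ := R.gamma_pos
  have hM := R.M_nonneg
  set σ := Real.sqrt (R.ω * R.ρ) with hσ
  have hσ0 : 0 ≤ σ := Real.sqrt_nonneg _
  set C₁ := K + R.γ + R.s * R.M + R.s * (2 * R.δ) * (R.ρ * (R.s * (2 * R.δ))) with hC₁
  set C₂ := R.s * (2 * R.δ) * σ with hC₂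
  have hC₁0 : 0 < C₁ := by positivity
  have hC₂0 : 0 ≤ C₂ := by positivity
  refine ⟨C₁ + C₂ + σ / R.ρ + σ, by positivity, fun U V U₁ V₁ w w₁ h h₁ hst => ?_⟩
  set D := ‖U₁ - U‖ + ‖V₁ - V‖ with hD
  have hD0 : 0 ≤ D := by positivity
  have hVD : ‖V₁ - V‖ ≤ D := le_add_of_nonneg_left (norm_nonneg _)
  have hmono : ∀ {c x : ℝ}, x ≤ c * D → c ≤ C₁ + C₂ + σ / R.ρ + σ →
      x ≤ (C₁ + C₂ + σ / R.ρ + σ) * D := fun hx hc =>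
    hx.trans (mul_le_mul_of_nonneg_right hc hD0)
  have hq0 : 0 ≤ σ / R.ρ := by positivity
  have hw : ‖w₁ - w‖ ≤ σ * D := h.norm_dual_sub_le h₁
  have hU₁ : ‖U₁‖ ≤ 2 * R.δ := by linarith [h₁.norm_le]
  have hadjw : ∀ X : H, ‖X‖ ≤ 2 * R.δ → ‖P.adj X (w₁ - w)‖ ≤ C₂ * D := fun X hX => by
    refine (R.adj_bound _ _).trans ?_
    calc R.s * ‖X‖ * ‖w₁ - w‖ ≤ R.s * (2 * R.δ) * (σ * D) := by gcongr
      _ = C₂ * D := by rw [hC₂]; ring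
  have hadd : ∀ X Y : H, P.lagGrad R.γ X Y (w₁ + R.ρ • P.res U₁ V₁)
      = P.lagGrad R.γ X Y w₁ + P.adj X (w₁ - w) := fun X Y => by
    rw [hst.res_eq, lagGrad, lagGrad, map_add]; abel
  have hfirst : ‖P.lagGrad R.γ V₁ U₁ w₁‖ ≤ C₁ * D := by
    have hopt : P.lagGrad R.γ V U₁ (w + R.ρ • P.res V U₁) = 0 :=
      P.lagGrad_eq_zero_of_forall_le fun U' => by
        simpa only [P.lag_symm _ _ V] using hst.minU U'
    have hw₁ : w₁ - (w + R.ρ • P.res V U₁) = R.ρ • P.constr U₁ (V₁ - V) := by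
      rw [hst.dual, P.res_symm V, ← P.res_sub, smul_sub]; abel
    have e : P.lagGrad R.γ V₁ U₁ w₁ = (P.partialGrad V₁ U₁ - P.partialGrad V U₁)
        - R.γ • (V₁ - V) + P.adj (V₁ - V) w₁ + P.adj V (R.ρ • P.constr U₁ (V₁ - V)) := by
      rw [← sub_zero (P.lagGrad R.γ V₁ U₁ w₁), ← hopt, ← hw₁]
      simp only [lagGrad, map_sub, LinearMap.sub_apply, smul_sub]
      abel
    have b1 : ‖P.partialGrad V₁ U₁ - P.partialGrad V U₁‖ ≤ K * D :=
      (hK U₁ V V₁ hU₁ h.norm_right_le h₁.norm_right_le).trans (by gcongr)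
    have b2 : ‖R.γ • (V₁ - V)‖ ≤ R.γ * D := by
      rw [norm_smul, Real.norm_of_nonneg hγ.le]; gcongr
    have b3 : ‖P.adj (V₁ - V) w₁‖ ≤ R.s * R.M * D := by
      refine (R.adj_bound _ _).trans ?_
      calc R.s * ‖V₁ - V‖ * ‖w₁‖ ≤ R.s * D * R.M := by
            gcongr
            exact h₁.norm_mult_le
        _ = R.s * R.M * D := by ring
    have b4 : ‖P.adj V (R.ρ • P.constr U₁ (V₁ - V))‖
        ≤ R.s * (2 * R.δ) * (R.ρ * (R.s * (2 * R.δ))) * D := by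
      refine (R.adj_bound _ _).trans ?_
      rw [norm_smul, Real.norm_of_nonneg hρ.le]
      calc R.s * ‖V‖ * (R.ρ * ‖P.constr U₁ (V₁ - V)‖)
          ≤ R.s * (2 * R.δ) * (R.ρ * (R.s * (2 * R.δ) * D)) := by
            gcongr
            · exact h.norm_right_le
            · refine (R.norm_constr_le _ _).trans ?_
              gcongr
        _ = R.s * (2 * R.δ) * (R.ρ * (R.s * (2 * R.δ))) * D := by ring
    rw [e]
    refine (norm_add_le _ _).trans ((add_le_add ((norm_add_le _ _).trans
      (add_le_add ((norm_sub_le _ _).trans (add_le_add b1 b2)) b3)) b4).trans_eq ?_)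
    rw [hC₁]; ring
  refine ⟨hmono hfirst (by linarith), ?_, ?_, ?_, hmono hw (by linarith)⟩
  · rw [hadd]
    refine hmono (c := C₁ + C₂) ((norm_add_le _ _).trans ?_) (by linarith)
    rw [add_mul]
    exact add_le_add hfirst (hadjw V₁ h₁.norm_right_le)
  · rw [hadd, h₁.stat, zero_add]
    exact hmono (hadjw U₁ hU₁) (by linarith)
  · refine hmono (c := σ / R.ρ) ?_ (by linarith)
    rw [div_mul_eq_mul_div, le_div_iff₀ hρ]
    have : ‖P.res U₁ V₁‖ * R.ρ = ‖w₁ - w‖ := by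
      rw [← hst.res_eq, norm_smul, Real.norm_of_nonneg hρ.le, mul_comm]
    rwa [this]

/-- Stationary and feasible triples. -/
def IsKKT (q : H × H × W) : Prop :=
  P.lagGrad R.γ q.2.1 q.1 q.2.2 = 0 ∧ P.lagGrad R.γ q.1 q.2.1 q.2.2 = 0 ∧ P.res q.1 q.2.1 = 0

open Filter Topology

/-- Convergence of the alternating scheme under a Łojasiewicz inequality at KKT triples. -/
theorem exists_tendsto_of_lojasiewicz [ProperSpace H] [ProperSpace W] [Nontrivial W] {α : ℝ}
    (hα0 : 0 ≤ α) (hα1 : α < 1)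
    (hkl : ∃ c ε : ℝ, 0 < c ∧ 0 < ε ∧ ∀ p q : H × H × W, R.IsKKT q → dist p q ≤ ε →
      |P.lag R.γ R.ρ p.1 p.2.1 p.2.2 - P.lag R.γ R.ρ q.1 q.2.1 q.2.2| ^ α
        ≤ c * (‖P.lagGrad R.γ p.2.1 p.1 (p.2.2 + R.ρ • P.res p.1 p.2.1)‖
          + ‖P.lagGrad R.γ p.1 p.2.1 (p.2.2 + R.ρ • P.res p.1 p.2.1)‖ + ‖P.res p.1 p.2.1‖))
    {U V : ℕ → H} {w : ℕ → W}
    (hstep : ∀ k, R.Step (U k) (V k) (w k) (U (k + 1)) (V (k + 1)) (w (k + 1)))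
    (hinit : P.lag R.γ R.ρ (U 0) (V 0) (w 0) + 1 / R.ρ * ‖w 0‖ ^ 2 ≤ R.β0) :
    (∃ q, R.IsKKT q ∧ Tendsto (fun k => (U k, V k, w k)) atTop (𝓝 q)) ∧
    ∃ (C : ℝ) (D : ℕ → ℝ), 0 ≤ C ∧ (∀ k, 0 ≤ D k) ∧ Summable D ∧ ∀ k,
      ‖P.lagGrad R.γ (V (k + 3)) (U (k + 3)) (w (k + 3))‖ ≤ C * D k ∧
      P.lagGrad R.γ (U (k + 3)) (V (k + 3)) (w (k + 3)) = 0 ∧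
      ‖P.res (U (k + 3)) (V (k + 3))‖ ≤ C * D k := by
  obtain ⟨c, ε, hc, hε, hkl⟩ := hkl
  obtain ⟨C, hC, hres⟩ := R.exists_residual_le
  have hinv : ∀ k, R.Inv (U (k + 2)) (V (k + 2)) (w (k + 2)) := by
    intro k
    induction k with
    | zero => exact ((hstep 0).start hinit).inv (hstep 1)
    | succ k ih => exact ih.step (hstep (k + 2))
  set z : ℕ → H × H × W := fun k => (U (k + 2), V (k + 2), w (k + 2)) with hz
  set D : ℕ → ℝ := fun k => ‖U (k + 3) - U (k + 2)‖ + ‖V (k + 3) - V (k + 2)‖ with hD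
  have hD0 : ∀ k, 0 ≤ D k := fun k => by positivity
  have hres' := fun k => hres _ _ _ _ _ _ (hinv k).toGood (hinv (k + 1)).toGood (hstep (k + 2))
  set ℓ : ℕ → ℝ := fun k => P.lag R.γ R.ρ (z k).1 (z k).2.1 (z k).2.2 with hℓ
  set κ := (R.γ / 2 - R.ω) / 2 with hκ
  have hκ0 : 0 < κ := half_pos (sub_pos.mpr R.ω_lt)
  have hdec : ∀ k, κ * D k ^ 2 ≤ ℓ k - ℓ (k + 1) := fun k => by
    have h1 := (hinv k).toGood.lag_decrease (hinv (k + 1)).toGood (hstep (k + 2))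
    have h2 : D k ^ 2 ≤ 2 * (‖U (k + 3) - U (k + 2)‖ ^ 2 + ‖V (k + 3) - V (k + 2)‖ ^ 2) :=
      add_sq_le
    have h3 := mul_le_mul_of_nonneg_left h2 hκ0.le
    have h4 : ℓ (k + 1) + (R.γ / 2 - R.ω) * (‖U (k + 3) - U (k + 2)‖ ^ 2
      + ‖V (k + 3) - V (k + 2)‖ ^ 2) ≤ ℓ k := h1
    rw [hκ] at h3 ⊢
    linarith
  have hanti : Antitone ℓ := antitone_nat_of_succ_le fun k => by
    have := hdec k
    have : 0 ≤ κ * D k ^ 2 := by positivity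
    linarith
  have hbdd : ∀ k, z k ∈ Metric.closedBall (0 : H) R.δ ×ˢ
      (Metric.closedBall (0 : H) (2 * R.δ) ×ˢ Metric.closedBall (0 : W) R.M) := fun k => by
    simp only [Set.mem_prod, mem_closedBall_zero_iff]
    exact ⟨(hinv k).norm_le, (hinv k).norm_right_le, (hinv k).norm_mult_le⟩
  have hcompact : IsCompact (Metric.closedBall (0 : H) R.δ ×ˢ
      (Metric.closedBall (0 : H) (2 * R.δ) ×ˢ Metric.closedBall (0 : W) R.M)) :=
    (isCompact_closedBall _ _).prod ((isCompact_closedBall _ _).prod (isCompact_closedBall _ _))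
  obtain ⟨q, -, φ, hφ, hq⟩ := hcompact.tendsto_subseq hbdd
  have hℓq : Tendsto ℓ atTop (𝓝 (P.lag R.γ R.ρ q.1 q.2.1 q.2.2)) :=
    (tendsto_iff_tendsto_subseq_of_antitone hanti hφ.tendsto_atTop).mpr
      (((P.continuous_lag_triple R.γ R.ρ).tendsto q).comp hq)
  have hD_lim : Tendsto D atTop (𝓝 0) := by
    have h1 : Tendsto (fun k => (ℓ k - ℓ (k + 1)) / κ) atTop (𝓝 0) := by
      simpa using (hℓq.sub ((tendsto_add_atTop_iff_nat 1).mpr hℓq)).div_const κ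
    have h2 : Tendsto (fun k => D k ^ 2) atTop (𝓝 0) :=
      squeeze_zero (fun k => sq_nonneg _)
        (fun k => by rw [le_div_iff₀ hκ0, mul_comm]; exact hdec k) h1
    have h3 := (Real.continuous_sqrt.tendsto 0).comp h2
    rw [Real.sqrt_zero] at h3
    exact h3.congr fun k => Real.sqrt_sq (hD0 k)
  have hzero : ∀ {F : H × H × W → ℝ}, Continuous F → (∀ p, 0 ≤ F p) →
      (∀ k, F (z (k + 1)) ≤ C * D k) → F q = 0 := fun {F} hF h0 hle => by
    have h1 : Tendsto (fun k => F (z (k + 1))) atTop (𝓝 0) :=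
      squeeze_zero (fun k => h0 _) hle (by simpa using hD_lim.const_mul C)
    have h2 : Tendsto (fun k => F (z k)) atTop (𝓝 0) := (tendsto_add_atTop_iff_nat 1).mp h1
    exact tendsto_nhds_unique ((hF.tendsto q).comp hq) (h2.comp hφ.tendsto_atTop)
  have hqKKT : R.IsKKT q := by
    refine ⟨norm_eq_zero.mp ?_, norm_eq_zero.mp ?_, norm_eq_zero.mp ?_⟩
    · refine hzero (F := fun q : H × H × W => ‖P.lagGrad R.γ q.2.1 q.1 q.2.2‖) ?_
        (fun _ => norm_nonneg _) fun k => (hres' k).1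
      exact ((P.continuous_lagGrad R.γ).comp
        (by fun_prop : Continuous fun q : H × H × W => (q.2.1, q.1, q.2.2))).norm
    · refine hzero (F := fun q : H × H × W => ‖P.lagGrad R.γ q.1 q.2.1 q.2.2‖)
        (P.continuous_lagGrad R.γ).norm (fun _ => norm_nonneg _) fun k => ?_
      simp only [hz]
      rw [(hinv (k + 1)).stat, norm_zero]
      exact mul_nonneg hC.le (hD0 k)
    · refine hzero (F := fun q : H × H × W => ‖P.res q.1 q.2.1‖) ?_
        (fun _ => norm_nonneg _) fun k => (hres' k).2.2.2.1
      exact (P.continuous_res.comp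
        (by fun_prop : Continuous fun q : H × H × W => (q.1, q.2.1))).norm
  set ℓ' := P.lag R.γ R.ρ q.1 q.2.1 q.2.2
  have hnonneg : ∀ k, 0 ≤ ℓ k - ℓ' := fun k => sub_nonneg.mpr (hanti.le_of_tendsto hℓq k)
  have hmain := summable_and_tendsto_of_lojasiewicz (z := z) (D := D) (l := fun k => ℓ k - ℓ')
    (q := q) (C₀ := 1 + C) (C₁ := c * (3 * C)) (κ := κ) (ε := ε) hα0 hα1 (by positivity)
    (by positivity) hκ0 hε hD0 hnonneg (by simpa using hℓq.sub_const ℓ')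
    (fun k => ?_) (fun k => by simpa using hdec k) (fun k hk => ?_) hφ.tendsto_atTop hq
  · refine ⟨⟨q, hqKKT, (tendsto_add_atTop_iff_nat 2).mp hmain.2⟩, C, D, hC.le, hD0, hmain.1,
      fun k => ⟨(hres' k).1, (hinv (k + 1)).stat, (hres' k).2.2.2.1⟩⟩
  · have h1 : ‖w (k + 3) - w (k + 2)‖ ≤ C * D k := (hres' k).2.2.2.2
    have h2 : 0 ≤ C * D k := mul_nonneg hC.le (hD0 k)
    rw [dist_comm, dist_eq_norm, add_mul, one_mul]
    refine max_le ?_ (max_le ?_ ?_)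
    · exact (le_add_of_nonneg_right (norm_nonneg (V (k + 3) - V (k + 2)))).trans
        (le_add_of_nonneg_right h2)
    · exact (le_add_of_nonneg_left (norm_nonneg (U (k + 3) - U (k + 2)))).trans
        (le_add_of_nonneg_right h2)
    · exact h1.trans (le_add_of_nonneg_left (hD0 k))
  · have h1 := hkl (z (k + 1)) q hqKKT hk
    rw [abs_of_nonneg (hnonneg (k + 1))] at h1
    refine h1.trans ?_
    rw [mul_assoc]
    refine mul_le_mul_of_nonneg_left ?_ hc.le
    obtain ⟨-, r1, r2, r3, -⟩ := hres' k
    refine (add_le_add (add_le_add r1 r2) r3).trans_eq ?_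
    simp only [hD]
    ring

end Regime

end FactoredModel

end FactoredModel

section Frobenius

variable {α β κ : Type*} [Fintype α] [Fintype β] [Fintype κ]

lemma continuous_mul_transpose {n r : ℕ} :
    Continuous fun p : Matrix (Fin n) (Fin r) ℝ × Matrix (Fin n) (Fin r) ℝ => p.1 * p.2ᵀ := by
  fun_prop

lemma continuous_Aop_mul_transpose {n m r : ℕ} (A : Fin m → Matrix (Fin n) (Fin n) ℝ) :
    Continuous fun p : Matrix (Fin n) (Fin r) ℝ × Matrix (Fin n) (Fin r) ℝ =>
      Aop A (p.1 * p.2ᵀ) := by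
  unfold Aop frobInner
  fun_prop

lemma continuous_sum_smul_mul {n m r : ℕ} (A : Fin m → Matrix (Fin n) (Fin n) ℝ) :
    Continuous fun p : Matrix (Fin n) (Fin r) ℝ × EuclideanSpace ℝ (Fin m) =>
      ∑ i, p.2 i • (A i * p.1) := by
  fun_prop

lemma continuous_gradient_mul {n r : ℕ} {grad : Matrix (Fin n) (Fin n) ℝ → Matrix (Fin n) (Fin n) ℝ}
    (h : Continuous grad) :
    Continuous fun p : Matrix (Fin n) (Fin r) ℝ × Matrix (Fin n) (Fin r) ℝ =>
      grad (p.2 * p.1ᵀ) * p.1 := by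
  fun_prop

lemma frobInner_eq_trace (X Y : Matrix α β ℝ) : frobInner X Y = (Xᵀ * Y).trace := by
  simp only [frobInner, Matrix.trace, Matrix.diag, Matrix.mul_apply, Matrix.transpose_apply]
  exact Finset.sum_comm

lemma frobInner_transpose (X Y : Matrix α β ℝ) : frobInner Xᵀ Yᵀ = frobInner X Y :=
  Finset.sum_comm

lemma frobInner_mul_left (G : Matrix α β ℝ) (U : Matrix β κ ℝ) (D : Matrix α κ ℝ) :
    frobInner (G * U) D = frobInner G (D * Uᵀ) := by
  rw [frobInner_eq_trace, frobInner_eq_trace, Matrix.transpose_mul, Matrix.mul_assoc,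
    Matrix.trace_mul_comm, Matrix.mul_assoc]

attribute [local instance] Matrix.frobeniusNormedAddCommGroup Matrix.frobeniusNormedSpace

lemma frobNorm_eq_norm (X : Matrix α β ℝ) : frobNorm X = ‖X‖ := by
  rw [Matrix.frobenius_norm_def, frobNorm, Real.sqrt_eq_rpow]
  simp

lemma vecNorm_eq_norm (v : α → ℝ) : vecNorm v = ‖WithLp.toLp 2 v‖ := by
  simp [vecNorm, EuclideanSpace.norm_eq]

/-- Real matrices as a Euclidean space. -/
@[reducible]
def frobeniusInnerProductSpace : InnerProductSpace ℝ (Matrix α β ℝ) :=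
  { Matrix.frobeniusNormedSpace with
    inner := frobInner
    norm_sq_eq_re_inner := fun X => by
      rw [← frobNorm_eq_norm, frobNorm, Real.sq_sqrt (by positivity)]
      simp [frobInner, sq]
    conj_inner_symm := fun X Y => by
      simp [frobInner, mul_comm]
    add_left := fun X Y Z => by
      simp [frobInner, add_mul, Finset.sum_add_distrib]
    smul_left := fun X Y t => by
      simp [frobInner, Finset.mul_sum, mul_assoc] }

attribute [local instance] frobeniusInnerProductSpace

open scoped RealInnerProductSpace

lemma inner_eq_frobInner (X Y : Matrix α β ℝ) : ⟪X, Y⟫ = frobInner X Y := rfl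

variable {n m r : ℕ} {f : Matrix (Fin n) (Fin n) ℝ → ℝ}
  {grad : Matrix (Fin n) (Fin n) ℝ → Matrix (Fin n) (Fin n) ℝ}
  {A : Fin m → Matrix (Fin n) (Fin n) ℝ}

lemma continuous_of_convexOn (hconv : ConvexOn ℝ Set.univ f) : Continuous f :=
  (ConvexOn.locallyLipschitz (E := Matrix (Fin n) (Fin n) ℝ) hconv).continuous

lemma gradient_transpose (hsym : ∀ X, f Xᵀ = f X)
    (hgrad : ∀ X H, HasDerivAt (fun t : ℝ => f (X + t • H)) (frobInner (grad X) H) 0)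
    (X : Matrix (Fin n) (Fin n) ℝ) : grad Xᵀ = (grad X)ᵀ := by
  refine ext_inner_right ℝ fun H => ?_
  have h := hgrad X Hᵀ
  rw [← frobInner_transpose, Matrix.transpose_transpose] at h
  refine (hgrad Xᵀ H).unique (h.congr_of_eventuallyEq (Filter.Eventually.of_forall fun t => ?_))
  simp only
  rw [← hsym (X + t • Hᵀ)]
  simp

lemma add_frobInner_gradient_le (hconv : ConvexOn ℝ Set.univ f)
    (hgrad : ∀ X H, HasDerivAt (fun t : ℝ => f (X + t • H)) (frobInner (grad X) H) 0)
    (X Y : Matrix (Fin n) (Fin n) ℝ) : f X + frobInner (grad X) (Y - X) ≤ f Y := by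
  have hc : ConvexOn ℝ Set.univ fun t : ℝ => f (X + t • (Y - X)) := by
    have := hconv.comp_affineMap (AffineMap.lineMap X Y)
    refine this.congr fun t _ => ?_
    simp [AffineMap.lineMap_apply, add_comm]
  have h := hc.le_slope_of_hasDerivAt (Set.mem_univ 0) (Set.mem_univ 1) one_pos (hgrad X (Y - X))
  simp [slope_def_field] at h
  linarith

lemma exists_gradient_lipschitz_on_ball
    (hlip : ∀ s : Set (Matrix (Fin n) (Fin n) ℝ), IsCompact s → Convex ℝ s →
      ∃ K : ℝ, ∀ X ∈ s, ∀ Y ∈ s, frobNorm (grad X - grad Y) ≤ K * frobNorm (X - Y)) (R : ℝ) :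
    ∃ K : ℝ, 0 ≤ K ∧ ∀ X Y, ‖X‖ ≤ R → ‖Y‖ ≤ R → ‖grad X - grad Y‖ ≤ K * ‖X - Y‖ := by
  have : ProperSpace (Matrix (Fin n) (Fin n) ℝ) := FiniteDimensional.proper_real _
  obtain ⟨K, hK⟩ := hlip (Metric.closedBall 0 R) (isCompact_closedBall 0 R)
    (convex_closedBall 0 R)
  refine ⟨max K 0, le_max_right _ _, fun X Y hX hY => ?_⟩
  have h := hK X (by simpa using hX) Y (by simpa using hY)
  rw [frobNorm_eq_norm, frobNorm_eq_norm] at h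
  exact h.trans (by gcongr; exact le_max_left _ _)

lemma norm_mul_transpose_le (X Y : Matrix (Fin n) (Fin r) ℝ) : ‖X * Yᵀ‖ ≤ ‖X‖ * ‖Y‖ := by
  simpa only [Matrix.frobenius_norm_transpose] using Matrix.frobenius_norm_mul X Yᵀ

lemma norm_mul_transpose_sub_le (X Y X' Y' : Matrix (Fin n) (Fin r) ℝ) :
    ‖X' * Y'ᵀ - X * Yᵀ‖ ≤ ‖X‖ * ‖Y' - Y‖ + ‖X' - X‖ * ‖Y'‖ := by
  have e : X' * Y'ᵀ - X * Yᵀ = X * (Y' - Y)ᵀ + (X' - X) * Y'ᵀ := by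
    rw [Matrix.transpose_sub, Matrix.mul_sub, Matrix.sub_mul]; abel
  rw [e]
  exact (norm_add_le _ _).trans (add_le_add (norm_mul_transpose_le _ _) (norm_mul_transpose_le _ _))

/-- The factored problem `f (U Vᵀ)` with constraints `𝒜 (U Vᵀ) = b`. -/
def matrixModel (hconv : ConvexOn ℝ Set.univ f) (hsym : ∀ X, f Xᵀ = f X)
    (hgrad : ∀ X H, HasDerivAt (fun t : ℝ => f (X + t • H)) (frobInner (grad X) H) 0)
    (hgradCont : Continuous grad)
    (hlip : ∀ s : Set (Matrix (Fin n) (Fin n) ℝ), IsCompact s → Convex ℝ s →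
      ∃ K : ℝ, ∀ X ∈ s, ∀ Y ∈ s, frobNorm (grad X - grad Y) ≤ K * frobNorm (X - Y))
    (hA : ∀ i, (A i)ᵀ = A i) (b : Fin m → ℝ) :
    FactoredModel (Matrix (Fin n) (Fin r) ℝ) (EuclideanSpace ℝ (Fin m)) where
  obj U V := f (U * Vᵀ)
  partialGrad U V := grad (V * Uᵀ) * U
  constr := LinearMap.mk₂ ℝ (fun U V => WithLp.toLp 2 (Aop A (U * Vᵀ)))
    (fun U U' V => by
      ext i
      simp [Aop, frobInner_eq_trace, Matrix.add_mul, Matrix.mul_add])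
    (fun t U V => by
      ext i
      simp [Aop, frobInner_eq_trace])
    (fun U V V' => by
      ext i
      simp [Aop, frobInner_eq_trace, Matrix.mul_add])
    (fun t U V => by
      ext i
      simp [Aop, frobInner_eq_trace])
  adj := LinearMap.mk₂ ℝ (fun U w => ∑ i, w i • (A i * U))
    (fun U U' w => by simp [Matrix.mul_add, Finset.sum_add_distrib])
    (fun t U w => by simp [Finset.smul_sum, smul_comm t])
    (fun U w w' => by simp [add_smul, Finset.sum_add_distrib])
    (fun t U w => by simp [Finset.smul_sum, smul_smul])
  rhs := WithLp.toLp 2 b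
  obj_symm U V := by rw [← hsym]; simp
  constr_symm U V := by
    ext i
    simp only [LinearMap.mk₂_apply, Aop]
    rw [← frobInner_transpose, hA]
    simp
  inner_adj U V w := by
    simp only [LinearMap.mk₂_apply, sum_inner, real_inner_smul_left, inner_eq_frobInner,
      frobInner_mul_left, PiLp.inner_apply, RCLike.inner_apply, conj_trivial]
    refine Finset.sum_congr rfl fun i _ => ?_
    rw [mul_comm, Aop, ← frobInner_transpose, hA]
    simp
  continuous_obj := (continuous_of_convexOn hconv).comp continuous_mul_transpose
  continuous_constr := (PiLp.continuous_toLp 2 _).comp (continuous_Aop_mul_transpose A)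
  continuous_adj := continuous_sum_smul_mul A
  continuous_partialGrad := continuous_gradient_mul hgradCont
  partialGrad_locally_lipschitz R := by
    obtain ⟨K, hK0, hK⟩ := exists_gradient_lipschitz_on_ball hlip (R ^ 2)
    refine ⟨K * |R| * |R| + (‖grad 0‖ + K * R ^ 2), by positivity, fun U V V' hU hV hV' => ?_⟩
    have hR : 0 ≤ R := (norm_nonneg U).trans hU
    have hb : ∀ X : Matrix (Fin n) (Fin r) ℝ, ‖X‖ ≤ R → ‖U * Xᵀ‖ ≤ R ^ 2 := fun X hX =>
      (norm_mul_transpose_le U X).trans (by rw [sq]; gcongr)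
    have e : grad (U * V'ᵀ) * V' - grad (U * Vᵀ) * V
        = (grad (U * V'ᵀ) - grad (U * Vᵀ)) * V' + grad (U * Vᵀ) * (V' - V) := by
      rw [Matrix.sub_mul, Matrix.mul_sub]; abel
    have h1 : ‖grad (U * V'ᵀ) - grad (U * Vᵀ)‖ ≤ K * (R * ‖V' - V‖) := by
      refine (hK _ _ (hb V' hV') (hb V hV)).trans ?_
      have := norm_mul_transpose_sub_le U V U V'
      rw [sub_self, norm_zero, zero_mul, add_zero] at this
      gcongr
      exact this.trans (by gcongr)
    have h2 : ‖grad (U * Vᵀ)‖ ≤ ‖grad 0‖ + K * R ^ 2 := by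
      have h := hK (U * Vᵀ) 0 (hb V hV) (by rw [norm_zero]; positivity)
      rw [sub_zero] at h
      have h' : K * ‖U * Vᵀ‖ ≤ K * R ^ 2 := by gcongr; exact hb V hV
      linarith [norm_sub_norm_le (grad (U * Vᵀ)) (grad 0)]
    rw [e, abs_of_nonneg hR, add_mul]
    refine (norm_add_le _ _).trans (add_le_add ((Matrix.frobenius_norm_mul _ _).trans ?_)
      ((Matrix.frobenius_norm_mul _ _).trans ?_))
    · calc ‖grad (U * V'ᵀ) - grad (U * Vᵀ)‖ * ‖V'‖ ≤ (K * (R * ‖V' - V‖)) * R := by gcongr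
        _ = K * R * R * ‖V' - V‖ := by ring
    · gcongr
  hasDerivAt_obj U V D := by
    have h := hgrad (U * Vᵀ) (U * Dᵀ)
    rw [inner_eq_frobInner, frobInner_mul_left, ← frobInner_transpose,
      ← gradient_transpose hsym hgrad]
    simpa [Matrix.mul_add] using h
  obj_lower U V V' := by
    have h := add_frobInner_gradient_le hconv hgrad (U * Vᵀ) (U * V'ᵀ)
    rw [inner_eq_frobInner, frobInner_mul_left, ← frobInner_transpose,
      ← gradient_transpose hsym hgrad]
    simpa [Matrix.mul_sub] using h
  obj_gauge t U V ht := by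
    simp [smul_smul, ht]

lemma norm_sum_smul_mul_le (A : Fin m → Matrix (Fin n) (Fin n) ℝ) (U : Matrix (Fin n) (Fin r) ℝ)
    (w : EuclideanSpace ℝ (Fin m)) :
    ‖∑ i, w i • (A i * U)‖ ≤ Real.sqrt (sA A) * ‖U‖ * ‖w‖ := by
  calc ‖∑ i, w i • (A i * U)‖ ≤ ∑ i, ‖w i‖ * (‖A i‖ * ‖U‖) :=
        norm_sum_le_of_le _ fun i _ => by
          rw [norm_smul]
          gcongr
          exact Matrix.frobenius_norm_mul _ _
    _ = (∑ i, ‖A i‖ * ‖w i‖) * ‖U‖ := by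
        rw [Finset.sum_mul]
        exact Finset.sum_congr rfl fun i _ => by ring
    _ ≤ (Real.sqrt (∑ i, ‖A i‖ ^ 2) * Real.sqrt (∑ i, ‖w i‖ ^ 2)) * ‖U‖ := by
        gcongr
        exact Real.sum_mul_le_sqrt_mul_sqrt _ _ _
    _ = Real.sqrt (sA A) * ‖U‖ * ‖w‖ := by
        rw [EuclideanSpace.norm_eq, sA]
        simp only [frobNorm_eq_norm]
        ring

lemma norm_sum_smul_mul_eq (U : Matrix (Fin n) (Fin r) ℝ) (w : EuclideanSpace ℝ (Fin m)) :
    ‖∑ i, w i • (A i * U)‖ = vecNorm ((Cmat A U).mulVec w) := by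
  rw [← frobNorm_eq_norm, frobNorm, vecNorm, Fintype.sum_prod_type]
  congr 1
  refine Finset.sum_congr rfl fun i _ => Finset.sum_congr rfl fun j _ => ?_
  simp [Matrix.sum_apply, Cmat, Matrix.mulVec, dotProduct, mul_comm]

lemma mul_norm_le_of_le_sigmaMin {η : ℝ} {U : Matrix (Fin n) (Fin r) ℝ}
    (h : η ≤ sigmaMin (Cmat A U)) (w : EuclideanSpace ℝ (Fin m)) :
    η * ‖w‖ ≤ ‖∑ i, w i • (A i * U)‖ := by
  rcases eq_or_ne w 0 with rfl | hw
  · simp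
  have hpos : 0 < ‖w‖ := norm_pos_iff.mpr hw
  have hle : sigmaMin (Cmat A U) ≤ vecNorm ((Cmat A U).mulVec (‖w‖⁻¹ • w).ofLp) := by
    refine csInf_le ⟨0, ?_⟩ ⟨_, ?_, rfl⟩
    · rintro _ ⟨x, -, rfl⟩
      exact Real.sqrt_nonneg _
    · rw [vecNorm_eq_norm]
      change ‖‖w‖⁻¹ • w‖ = 1
      rw [norm_smul, norm_inv, norm_norm, inv_mul_cancel₀ hpos.ne']
  rw [← norm_sum_smul_mul_eq] at hle
  have e : ∑ i, (‖w‖⁻¹ • w) i • (A i * U) = ‖w‖⁻¹ • ∑ i, w i • (A i * U) := by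
    simp [Finset.smul_sum, smul_smul]
  rw [e, norm_smul, norm_inv, norm_norm] at hle
  rw [mul_comm]
  exact (le_inv_mul_iff₀ hpos).mp (h.trans hle)

lemma norm_gradient_mul_le {Lf d : ℝ} (hgradB : ∀ X, frobNorm X ≤ d → frobNorm (grad X) ≤ Lf)
    {U V : Matrix (Fin n) (Fin r) ℝ} (h : ‖U‖ * ‖V‖ ≤ d) :
    ‖grad (V * Uᵀ) * U‖ ≤ Lf * ‖U‖ := by
  refine (Matrix.frobenius_norm_mul _ _).trans ?_
  gcongr
  simpa only [frobNorm_eq_norm] using hgradB (V * Uᵀ) (by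
    rw [frobNorm_eq_norm]
    exact (norm_mul_transpose_le V U).trans (by rwa [mul_comm]))

lemma norm_gradient_mul_sub_le {Lf L δ : ℝ} (hL : 0 ≤ L)
    (hgradB : ∀ X, frobNorm X ≤ δ ^ 2 → frobNorm (grad X) ≤ Lf)
    (hgradLip : ∀ X Y, frobNorm X ≤ δ ^ 2 → frobNorm Y ≤ δ ^ 2 →
      frobNorm (grad X - grad Y) ≤ L * frobNorm (X - Y))
    {U V U' V' : Matrix (Fin n) (Fin r) ℝ} (hU : ‖U‖ ≤ δ) (hU' : ‖U'‖ ≤ δ)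
    (h : ‖U‖ * ‖V‖ ≤ δ ^ 2) (h' : ‖U'‖ * ‖V'‖ ≤ δ ^ 2) :
    ‖grad (V' * U'ᵀ) * U' - grad (V * Uᵀ) * U‖
      ≤ (L * δ ^ 2 + Lf) * ‖U' - U‖ + L * δ ^ 2 * ‖V' - V‖ := by
  simp only [frobNorm_eq_norm] at hgradB hgradLip
  have hδ : 0 ≤ δ := (norm_nonneg U).trans hU
  have hX : ‖V * Uᵀ‖ ≤ δ ^ 2 := (norm_mul_transpose_le V U).trans (by rwa [mul_comm])
  have hX' : ‖V' * U'ᵀ‖ ≤ δ ^ 2 := (norm_mul_transpose_le V' U').trans (by rwa [mul_comm])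
  have e : grad (V' * U'ᵀ) * U' - grad (V * Uᵀ) * U
      = (grad (V' * U'ᵀ) - grad (V * Uᵀ)) * U + grad (V' * U'ᵀ) * (U' - U) := by
    rw [Matrix.sub_mul, Matrix.mul_sub]; abel
  have h1 : ‖(grad (V' * U'ᵀ) - grad (V * Uᵀ)) * U‖
      ≤ L * (‖V‖ * ‖U' - U‖ + ‖V' - V‖ * ‖U'‖) * ‖U‖ := by
    refine (Matrix.frobenius_norm_mul _ _).trans ?_
    gcongr
    refine (hgradLip _ _ hX' hX).trans ?_
    gcongr
    exact norm_mul_transpose_sub_le V U V' U'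
  have h2 : ‖grad (V' * U'ᵀ) * (U' - U)‖ ≤ Lf * ‖U' - U‖ := by
    refine (Matrix.frobenius_norm_mul _ _).trans ?_
    gcongr
    exact hgradB _ hX'
  have h3 : ‖U'‖ * ‖U‖ ≤ δ ^ 2 := by rw [sq]; gcongr
  rw [e]
  refine (norm_add_le _ _).trans ?_
  calc _ ≤ L * (‖V‖ * ‖U' - U‖ + ‖V' - V‖ * ‖U'‖) * ‖U‖ + Lf * ‖U' - U‖ := add_le_add h1 h2
    _ = L * (‖U‖ * ‖V‖) * ‖U' - U‖ + L * (‖U'‖ * ‖U‖) * ‖V' - V‖ + Lf * ‖U' - U‖ := by ring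
    _ ≤ L * δ ^ 2 * ‖U' - U‖ + L * δ ^ 2 * ‖V' - V‖ + Lf * ‖U' - U‖ := by gcongr
    _ = _ := by ring

section Translation

variable {hconv : ConvexOn ℝ Set.univ f} {hsym : ∀ X, f Xᵀ = f X}
  {hgrad : ∀ X H, HasDerivAt (fun t : ℝ => f (X + t • H)) (frobInner (grad X) H) 0}
  {hgradCont : Continuous grad}
  {hlip : ∀ s : Set (Matrix (Fin n) (Fin n) ℝ), IsCompact s → Convex ℝ s →
    ∃ K : ℝ, ∀ X ∈ s, ∀ Y ∈ s, frobNorm (grad X - grad Y) ≤ K * frobNorm (X - Y)}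
  {hA : ∀ i, (A i)ᵀ = A i} {b : Fin m → ℝ} {U V : Matrix (Fin n) (Fin r) ℝ} {w : Fin m → ℝ}

lemma vecNorm_residual_eq : vecNorm (fun i => Aop A (U * Vᵀ) i - b i)
    = ‖(matrixModel hconv hsym hgrad hgradCont hlip hA b).res U V‖ :=
  vecNorm_eq_norm _

lemma augL_eq_lag (ρ γ : ℝ) : augL f A b ρ γ U V w
    = (matrixModel hconv hsym hgrad hgradCont hlip hA b).lag γ ρ U V (WithLp.toLp 2 w) := by
  rw [augL, vecNorm_residual_eq (hconv := hconv) (hsym := hsym) (hgrad := hgrad)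
    (hgradCont := hgradCont) (hlip := hlip) (hA := hA), frobNorm_eq_norm, FactoredModel.lag,
    PiLp.inner_apply]
  simp only [RCLike.inner_apply, conj_trivial, mul_comm]
  rfl

lemma mem_Sset_iff (ρ₀ β : ℝ) : (U, V) ∈ Sset (r := r) f A b ρ₀ β ↔
    (matrixModel hconv hsym hgrad hgradCont hlip hA b).lag ρ₀ ρ₀ U V 0 ≤ β := by
  rw [FactoredModel.lag_zero, ← vecNorm_residual_eq, ← frobNorm_eq_norm]
  rfl

lemma isPenEpsKKT_iff (γ ε : ℝ) : IsPenEpsKKT grad A b γ ε U V w ↔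
    ‖(matrixModel hconv hsym hgrad hgradCont hlip hA b).lagGrad γ V U (WithLp.toLp 2 w)‖ ≤ ε ∧
    ‖(matrixModel hconv hsym hgrad hgradCont hlip hA b).lagGrad γ U V (WithLp.toLp 2 w)‖ ≤ ε ∧
    ‖(matrixModel hconv hsym hgrad hgradCont hlip hA b).res U V‖ ≤ ε := by
  rw [← vecNorm_residual_eq, ← frobNorm_eq_norm, ← frobNorm_eq_norm]
  rfl

lemma gradAugLNorm_le (ρ γ : ℝ) : gradAugLNorm grad A b ρ γ U V w ≤
    ‖(matrixModel hconv hsym hgrad hgradCont hlip hA b).lagGrad γ V U (WithLp.toLp 2 w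
      + ρ • (matrixModel hconv hsym hgrad hgradCont hlip hA b).res U V)‖
    + ‖(matrixModel hconv hsym hgrad hgradCont hlip hA b).lagGrad γ U V (WithLp.toLp 2 w
      + ρ • (matrixModel hconv hsym hgrad hgradCont hlip hA b).res U V)‖
    + ‖(matrixModel hconv hsym hgrad hgradCont hlip hA b).res U V‖ := by
  have key : ∀ x y z : ℝ, 0 ≤ x → 0 ≤ y → 0 ≤ z → Real.sqrt (x ^ 2 + y ^ 2 + z ^ 2) ≤ x + y + z :=
    fun x y z hx hy hz => Real.sqrt_le_iff.mpr ⟨by positivity, by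
      nlinarith [mul_nonneg hx hy, mul_nonneg hx hz, mul_nonneg hy hz]⟩
  refine le_of_eq_of_le ?_ (key _ _ _ (norm_nonneg _) (norm_nonneg _) (norm_nonneg _))
  rw [← vecNorm_residual_eq, ← frobNorm_eq_norm, ← frobNorm_eq_norm]
  rfl

lemma tripDist_le (p q : Matrix (Fin n) (Fin r) ℝ × Matrix (Fin n) (Fin r) ℝ ×
    EuclideanSpace ℝ (Fin m)) :
    tripDist (p.1, p.2.1, p.2.2.ofLp) (q.1, q.2.1, q.2.2.ofLp) ≤ 2 * dist p q := by
  have e : tripDist (p.1, p.2.1, p.2.2.ofLp) (q.1, q.2.1, q.2.2.ofLp) = Real.sqrt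
      (dist p.1 q.1 ^ 2 + dist p.2.1 q.2.1 ^ 2 + dist p.2.2 q.2.2 ^ 2) := by
    rw [tripDist, frobNorm_eq_norm, frobNorm_eq_norm, vecNorm_eq_norm, dist_eq_norm, dist_eq_norm,
      dist_eq_norm]
    rfl
  have h1 : dist p.1 q.1 ≤ dist p q := le_max_left _ _
  have h2 : dist p.2.1 q.2.1 ≤ dist p q := (le_max_left _ _).trans (le_max_right _ _)
  have h3 : dist p.2.2 q.2.2 ≤ dist p q := (le_max_right _ _).trans (le_max_right _ _)
  rw [e]
  refine Real.sqrt_le_iff.mpr ⟨by positivity, ?_⟩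
  have s1 := pow_le_pow_left₀ dist_nonneg h1 2
  have s2 := pow_le_pow_left₀ dist_nonneg h2 2
  have s3 := pow_le_pow_left₀ dist_nonneg h3 2
  nlinarith [sq_nonneg (dist p q)]

variable (hconv hsym hgrad hgradCont hlip hA b)

lemma exists_regime {ρ γ ρ₀ β0 βhat δ Lf L η c₁ c₂ : ℝ} (hρ : 0 < ρ) (hγ : 0 < γ) (hρ₀ : 0 < ρ₀)
    (hlevel : ∀ β : ℝ, IsCompact (Sset (r := r) f A b ρ₀ β) ∨ Sset (r := r) f A b ρ₀ β = ∅)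
    (hββ : β0 < βhat) (hδ : 0 < δ)
    (hδB : ∀ p ∈ Sset (r := r) f A b ρ₀ βhat, frobNorm p.1 ≤ δ ∧ frobNorm p.2 ≤ δ)
    (hLf : 0 < Lf) (hL : 0 < L)
    (hgradB : ∀ X : Matrix (Fin n) (Fin n) ℝ, frobNorm X ≤ δ ^ 2 → frobNorm (grad X) ≤ Lf)
    (hgradLip : ∀ X Y : Matrix (Fin n) (Fin n) ℝ, frobNorm X ≤ δ ^ 2 → frobNorm Y ≤ δ ^ 2 →
      frobNorm (grad X - grad Y) ≤ L * frobNorm (X - Y))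
    (hη : 0 < η) (hηB : ∀ p ∈ Sset (r := r) f A b ρ₀ βhat, η ≤ sigmaMin (Cmat A p.1))
    (hc₁ : c₁ = 2 / η ^ 2 * (L * δ ^ 2 + Lf + γ + 1 / η * Lf * δ * Real.sqrt (sA A)
      + 2 / η * γ * δ * Real.sqrt (sA A)) ^ 2)
    (hc₂ : c₂ = 2 / η ^ 2 * (L * δ ^ 2 + γ) ^ 2)
    (hγρ₀ : ρ₀ < γ)
    (hρbig : max (max (2 * ρ₀) (2 * c₁ / γ))
      (max (2 * c₂ / γ) (((Lf * δ + 2 * γ * δ) / η) ^ 2 / (βhat - β0))) < ρ) :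
    ∃ R : FactoredModel.Regime
        (matrixModel (r := r) hconv hsym hgrad hgradCont hlip hA b),
      R.γ = γ ∧ R.ρ = ρ ∧ R.β0 = β0 := by
  obtain ⟨⟨hρ1, hρ2⟩, hρ3, hρ4⟩ : (2 * ρ₀ < ρ ∧ 2 * c₁ / γ < ρ) ∧ 2 * c₂ / γ < ρ ∧
      ((Lf * δ + 2 * γ * δ) / η) ^ 2 / (βhat - β0) < ρ := by
    simpa only [max_lt_iff] using hρbig
  rw [div_lt_iff₀ hγ] at hρ2 hρ3
  rw [div_lt_iff₀ (sub_pos.mpr hββ)] at hρ4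
  have hset : {p : Matrix (Fin n) (Fin r) ℝ × Matrix (Fin n) (Fin r) ℝ |
      (matrixModel (r := r) hconv hsym hgrad hgradCont hlip hA b).lag ρ₀ ρ₀ p.1 p.2 0 ≤ βhat}
      = Sset f A b ρ₀ βhat := by
    ext p
    exact (mem_Sset_iff ρ₀ βhat).symm
  refine ⟨{
    γ := γ, ρ := ρ, ρ₀ := ρ₀, δ := δ, η := η, Lf := Lf, a₁ := L * δ ^ 2 + Lf, a₂ := L * δ ^ 2
    s := Real.sqrt (sA A), M := (Lf * δ + 2 * γ * δ) / η, ω := max c₁ c₂ / ρ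
    β0 := β0, βhat := βhat
    rho0_pos := hρ₀, rho0_lt := hγρ₀, two_rho0_lt := hρ1, delta_pos := hδ, eta_pos := hη
    Lf_nonneg := hLf.le, a₁_nonneg := by positivity, a₂_nonneg := by positivity
    s_nonneg := Real.sqrt_nonneg _, M_nonneg := by positivity
    level_compact := ?_
    norm_le := fun U V h => ?_
    le_adj := fun U V h w => ?_
    grad_bound := fun U V h => norm_gradient_mul_le hgradB h
    grad_lip := fun U V U' V' hU hU' h h' =>
      norm_gradient_mul_sub_le hL.le hgradB hgradLip hU hU' h h'
    adj_bound := norm_sum_smul_mul_le A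
    eta_M := by field_simp
    M_sq_lt := hρ4
    first_weight := ?_
    second_weight := ?_
    ω_lt := ?_ }, rfl, rfl, rfl⟩
  · rw [hset]
    exact (hlevel βhat).elim id fun h => by rw [h]; exact isCompact_empty
  · rw [← frobNorm_eq_norm]
    exact (hδB (U, V) ((mem_Sset_iff ρ₀ βhat).mpr h)).1
  · exact mul_norm_le_of_le_sigmaMin (hηB (U, V) ((mem_Sset_iff ρ₀ βhat).mpr h)) w
  · rw [div_mul_cancel₀ _ hρ.ne']
    refine le_of_eq_of_le ?_ (mul_le_mul_of_nonneg_left (le_max_left c₁ c₂) (by positivity))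
    rw [hc₁]
    field_simp
    ring
  · rw [div_mul_cancel₀ _ hρ.ne']
    refine le_of_eq_of_le ?_ (mul_le_mul_of_nonneg_left (le_max_right c₁ c₂) (by positivity))
    rw [hc₂]
    field_simp
  · rw [div_lt_iff₀ hρ]
    exact max_lt (by linarith) (by linarith)

end Translation

end Frobenius

/-- Theorem 3.1: global convergence of the ADMM sequence to a KKT point of
the penalized problem, and O(ε⁻¹) iteration complexity for reaching an ε-KKT point. -/
theorem admm_global_convergence
    (n m r : ℕ) (hn : 0 < n) (hm : 0 < m) (hr : 0 < r)
    (f : Matrix (Fin n) (Fin n) ℝ → ℝ)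
    (hconv : ConvexOn ℝ Set.univ f)
    (hsym : ∀ X : Matrix (Fin n) (Fin n) ℝ, f Xᵀ = f X)
    (grad : Matrix (Fin n) (Fin n) ℝ → Matrix (Fin n) (Fin n) ℝ)
    (hgrad : ∀ X H : Matrix (Fin n) (Fin n) ℝ,
      HasDerivAt (fun t : ℝ => f (X + t • H)) (frobInner (grad X) H) 0)
    (hgradCont : Continuous grad)
    (hess : Matrix (Fin n) (Fin n) ℝ → Matrix (Fin n) (Fin n) ℝ → Matrix (Fin n) (Fin n) ℝ)
    (hhess : ∀ X H : Matrix (Fin n) (Fin n) ℝ, ∀ i j,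
      HasDerivAt (fun t : ℝ => grad (X + t • H) i j) (hess X H i j) 0)
    (hgradLipCompact : ∀ s : Set (Matrix (Fin n) (Fin n) ℝ), IsCompact s → Convex ℝ s →
      ∃ K : ℝ, ∀ X ∈ s, ∀ Y ∈ s, frobNorm (grad X - grad Y) ≤ K * frobNorm (X - Y))
    (hhessLipCompact : ∀ s : Set (Matrix (Fin n) (Fin n) ℝ), IsCompact s → Convex ℝ s →
      ∃ K : ℝ, ∀ X ∈ s, ∀ Y ∈ s, ∀ H : Matrix (Fin n) (Fin n) ℝ,
        frobNorm (hess X H - hess Y H) ≤ K * frobNorm H * frobNorm (X - Y))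
    (A : Fin m → Matrix (Fin n) (Fin n) ℝ) (hAsym : ∀ i, (A i)ᵀ = A i)
    (b : Fin m → ℝ)
    (hfeas : ∃ Uf Vf : Matrix (Fin n) (Fin r) ℝ, ∀ i, Aop A (Uf * Vfᵀ) i = b i)
    (hWne : (KKTset r grad A b γ).Nonempty)
    (ρ γ ρ₀ : ℝ) (hρpos : 0 < ρ) (hγpos : 0 < γ) (hρ₀pos : 0 < ρ₀)
    (U V : ℕ → Matrix (Fin n) (Fin r) ℝ) (lam : ℕ → Fin m → ℝ)
    (hUmin : ∀ k : ℕ, ∀ U' : Matrix (Fin n) (Fin r) ℝ,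
      augL f A b ρ γ (U (k + 1)) (V k) (lam k) ≤ augL f A b ρ γ U' (V k) (lam k))
    (hVmin : ∀ k : ℕ, ∀ V' : Matrix (Fin n) (Fin r) ℝ,
      augL f A b ρ γ (U (k + 1)) (V (k + 1)) (lam k) ≤ augL f A b ρ γ (U (k + 1)) V' (lam k))
    (hlamUpd : ∀ k : ℕ,
      lam (k + 1) = fun i => lam k i + ρ * (Aop A (U (k + 1) * (V (k + 1))ᵀ) i - b i))
    (hlevel : ∀ β : ℝ, IsCompact (Sset (r := r) f A b ρ₀ β) ∨ Sset (r := r) f A b ρ₀ β = ∅)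
    (β0 βhat : ℝ) (hββ : β0 < βhat)
    (hinit : augL f A b ρ γ (U 0) (V 0) (lam 0) + 1 / ρ * (vecNorm (lam 0)) ^ 2 ≤ β0)
    (δ : ℝ) (hδpos : 0 < δ)
    (hδB : ∀ p ∈ Sset (r := r) f A b ρ₀ βhat, frobNorm p.1 ≤ δ ∧ frobNorm p.2 ≤ δ)
    (Lf L : ℝ) (hLfpos : 0 < Lf) (hLpos : 0 < L)
    (hgradB : ∀ X : Matrix (Fin n) (Fin n) ℝ, frobNorm X ≤ δ ^ 2 → frobNorm (grad X) ≤ Lf)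
    (hgradLip : ∀ X Y : Matrix (Fin n) (Fin n) ℝ, frobNorm X ≤ δ ^ 2 → frobNorm Y ≤ δ ^ 2 →
      frobNorm (grad X - grad Y) ≤ L * frobNorm (X - Y))
    (η : ℝ) (hηpos : 0 < η)
    (hηB : ∀ p ∈ Sset (r := r) f A b ρ₀ βhat, η ≤ sigmaMin (Cmat A p.1))
    (c₁ c₂ : ℝ)
    (hc₁ : c₁ = 2 / η ^ 2 * (L * δ ^ 2 + Lf + γ + 1 / η * Lf * δ * Real.sqrt (sA A)
      + 2 / η * γ * δ * Real.sqrt (sA A)) ^ 2)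
    (hc₂ : c₂ = 2 / η ^ 2 * (L * δ ^ 2 + γ) ^ 2)
    (hγρ₀ : ρ₀ < γ)
    (hρbig : max (max (2 * ρ₀) (2 * c₁ / γ))
      (max (2 * c₂ / γ) (((Lf * δ + 2 * γ * δ) / η) ^ 2 / (βhat - β0))) < ρ)
    (α : ℝ) (hα0 : 0 ≤ α) (hα1 : α < 1)
    (hLoj : ∃ c δc : ℝ, 0 < c ∧ 0 < δc ∧
      ∀ p q : Matrix (Fin n) (Fin r) ℝ × Matrix (Fin n) (Fin r) ℝ × (Fin m → ℝ),
        q ∈ KKTset r grad A b γ → tripDist p q ≤ δc →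
        |augL f A b ρ γ p.1 p.2.1 p.2.2 - augL f A b ρ γ q.1 q.2.1 q.2.2| ^ α
          ≤ c * gradAugLNorm grad A b ρ γ p.1 p.2.1 p.2.2)
    :
    (∃ q ∈ KKTset r grad A b γ,
      Filter.Tendsto (fun k => (U k, V k, lam k)) Filter.atTop (nhds q)) ∧
    ∃ Ccmp : ℝ, 0 < Ccmp ∧ ∀ ε : ℝ, 0 < ε →
      ∃ k : ℕ, (k : ℝ) ≤ Ccmp / ε ∧ IsPenEpsKKT grad A b γ ε (U k) (V k) (lam k) := by
  let _ : NormedAddCommGroup (Matrix (Fin n) (Fin r) ℝ) := Matrix.frobeniusNormedAddCommGroup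
  let _ : InnerProductSpace ℝ (Matrix (Fin n) (Fin r) ℝ) := frobeniusInnerProductSpace
  have : ProperSpace (Matrix (Fin n) (Fin r) ℝ) := FiniteDimensional.proper_real _
  have : Nonempty (Fin m) := ⟨⟨0, hm⟩⟩
  obtain ⟨R, rfl, rfl, rfl⟩ := exists_regime hconv hsym hgrad hgradCont hgradLipCompact hAsym b
    hρpos hγpos hρ₀pos hlevel hββ hδpos hδB hLfpos hLpos hgradB hgradLip hηpos hηB hc₁ hc₂ hγρ₀
    hρbig
  have hKKT : ∀ q, R.IsKKT q → (q.1, q.2.1, q.2.2.ofLp) ∈ KKTset r grad A b R.γ := fun q hq =>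
    (isPenEpsKKT_iff _ _).mpr ⟨(norm_eq_zero.mpr hq.1).le, (norm_eq_zero.mpr hq.2.1).le,
      (norm_eq_zero.mpr hq.2.2).le⟩
  have hstep : ∀ k, R.Step (U k) (V k) (WithLp.toLp 2 (lam k)) (U (k + 1)) (V (k + 1))
      (WithLp.toLp 2 (lam (k + 1))) := fun k =>
    ⟨fun U' => by rw [← augL_eq_lag, ← augL_eq_lag]; exact hUmin k U',
      fun V' => by rw [← augL_eq_lag, ← augL_eq_lag]; exact hVmin k V',
      by rw [hlamUpd k]; rfl⟩
  have hstart : (matrixModel hconv hsym hgrad hgradCont hgradLipCompact hAsym b).lag R.γ R.ρ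
      (U 0) (V 0) (WithLp.toLp 2 (lam 0)) + 1 / R.ρ * ‖WithLp.toLp 2 (lam 0)‖ ^ 2 ≤ R.β0 := by
    rw [← augL_eq_lag, ← vecNorm_eq_norm]
    exact hinit
  obtain ⟨c, δc, hc, hδc, hkl⟩ := hLoj
  obtain ⟨⟨q, hq, hlim⟩, C, D, hC, hD, hsum, hres⟩ := R.exists_tendsto_of_lojasiewicz hα0 hα1
    ⟨c, δc / 2, hc, half_pos hδc, fun p q hq hpq => by
      have h := hkl (p.1, p.2.1, p.2.2.ofLp) (q.1, q.2.1, q.2.2.ofLp) (hKKT q hq)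
        ((tripDist_le p q).trans (by linarith))
      simp only [augL_eq_lag (hconv := hconv) (hsym := hsym) (hgrad := hgrad)
        (hgradCont := hgradCont) (hlip := hgradLipCompact) (hA := hAsym)] at h
      exact h.trans (mul_le_mul_of_nonneg_left (gradAugLNorm_le _ _) hc.le)⟩ hstep hstart
  refine ⟨⟨_, hKKT q hq, ?_⟩, ?_⟩
  · have hcont : Continuous fun p : Matrix (Fin n) (Fin r) ℝ × Matrix (Fin n) (Fin r) ℝ ×
        EuclideanSpace ℝ (Fin m) => (p.1, p.2.1, p.2.2.ofLp) :=
      continuous_fst.prodMk ((continuous_fst.comp continuous_snd).prodMk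
        ((PiLp.continuous_ofLp 2 _).comp (continuous_snd.comp continuous_snd)))
    exact (hcont.tendsto q).comp hlim
  · let P := matrixModel (r := r) hconv hsym hgrad hgradCont hgradLipCompact hAsym b
    let e : ℕ → ℝ := fun k => max ‖P.lagGrad R.γ (V k) (U k) (WithLp.toLp 2 (lam k))‖
      (max ‖P.lagGrad R.γ (U k) (V k) (WithLp.toLp 2 (lam k))‖ ‖P.res (U k) (V k)‖)
    have he : ∀ k, e (k + 3) ≤ C * D k := fun k => by
      refine max_le (hres k).1 (max_le ?_ (hres k).2.2)
      rw [(hres k).2.1, norm_zero]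
      exact mul_nonneg hC (hD k)
    obtain ⟨K, hK, h⟩ := exists_index_le_div_of_summable hC hD hsum he
    refine ⟨K, hK, fun ε hε => ?_⟩
    obtain ⟨k, hk, hke⟩ := h ε hε
    obtain ⟨h1, h2⟩ := max_le_iff.mp hke
    exact ⟨k, hk, (isPenEpsKKT_iff _ _).mpr ⟨h1, max_le_iff.mp h2⟩⟩
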